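/- Classification of singular vectors of degree 1: Let F be an irreducible finite-dimensional g_0-module with highest weight μ=(m,n,μ_t,μ_C). A vector in Ind(F) is a nontrivial highest weight singular vector of degree 1 if and only if, up to scalar, it is one of: (a) μ=(m,n,−(m+n)/2,(m−n)/2) with m,n∈ℤ_{≥0} and vector w_{11}⊗x_1^m y_1^n; (b) μ=(m,n,1+(m−n)/2,−1−(m+n)/2) with m∈ℤ_{>0}, n∈ℤ_{≥0} and vector w_{21}⊗x_1^m y_1^n − w_{11}⊗x_1^{m−1}x_2 y_1^n; (c) μ=(m,n,2+(m+n)/2,(n−m)/2) with m,n∈ℤ_{>0} and vector w_{22}⊗x_1^m y_1^n − w_{12}⊗x_1^{m−1}x_2 y_1^n − w_{21}⊗x_1^m y_1^{n−1}y_2 + w_{11}⊗x_1^{m−1}x_2 y_1^{n−1}y_2; (d) μ=(m,n,1+(n−m)/2,1+(m+n)/2) with m∈ℤ_{≥0}, n∈ℤ_{>0} and vector w_{12}⊗x_1^m y_1^n − w_{11}⊗x_1^m y_1^{n−1}y_2. -/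

import Mathlib

/-!
Core definitions modelling the annihilation superalgebra `𝔤 = 𝒜(K'₄) = K(1,4)₊ ⊕ ℂC`
and generalized Verma modules `Ind F ≅ ℂ[Θ] ⊗ Λ(η₁,…,η₄) ⊗ F` over it.

Grassmann monomials `ξ_I`/`η_I` (with `I` in increasing order) are indexed by
`Idx = Finset (Fin 4)`.
-/

open Finset

noncomputable section

/-- Index set of a Grassmann monomial in `ξ₁,…,ξ₄` (0-indexed). -/
abbrev Idx : Type := Finset (Fin 4)

/-- Sign appearing when multiplying two Grassmann monomials: `ξ_I ξ_J = msign I J • ξ_{I ∪ J}`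
(for `I, J` disjoint). -/
def msign (I J : Idx) : ℤ := (-1 : ℤ) ^ ((I ×ˢ J).filter (fun p => p.2 < p.1)).card

/-- Sign of `∂ᵢ ξ_I` (for `i ∈ I`): `∂ᵢ ξ_I = dsign i I • ξ_{I \ {i}}`. -/
def dsign (i : Fin 4) (I : Idx) : ℤ := (-1 : ℤ) ^ (I.filter (fun j => j < i)).card

/-- Sign of the iterated derivative `∂_S η_L = ∂_{s₁} ⋯ ∂_{s_k} η_L` (`s₁ < ⋯ < s_k`,
`S ⊆ L`): `∂_S η_L = ddsign S L • η_{L \ S}`. -/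
def ddsign (S L : Idx) : ℤ :=
  (-1 : ℤ) ^ (S.card * (S.card - 1) / 2) *
    (-1 : ℤ) ^ (∑ i ∈ S, ((L \ S).filter (fun j => j < i)).card)

/-- `epsSign I` is the sign `ε_I` of the permutation `(I, Iᶜ)` of `(1,2,3,4)`. -/
def epsSign (I : Idx) : ℤ := msign I Iᶜ

variable (F : Type*) [AddCommGroup F] [Module ℂ F]

/-- The generalized Verma module `Ind F = ℂ[Θ] ⊗ Λ(η₁,…,η₄) ⊗ F`,
with `(k, L)`-component the coefficient of `Θ^k η_L`. -/
abbrev VInd : Type _ := (ℕ × Idx) →₀ F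

variable {F}

/-- Basis-type element `Θ^k η_L ⊗ v` of `Ind F`. -/
def bv (k : ℕ) (L : Idx) (v : F) : VInd F := Finsupp.single (k, L) v

/-- Action of the central element `C` on `Ind F`: it acts through its action `ρC` on `F`. -/
def Cop (ρC : F →ₗ[ℂ] F) : VInd F →ₗ[ℂ] VInd F := Finsupp.mapRange.linearMap ρC

/-- Multiplication by `Θ` on `Ind F`. -/
def thOp : VInd F →ₗ[ℂ] VInd F := Finsupp.lmapDomain F ℂ (fun p => (p.1 + 1, p.2))

/-- The 2-cocycle `ψ` on `K(1,4)₊` defining the central extension `𝒜(K'₄)`, evaluated on the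
basis monomials `t^0 ξ_I`, `t^0 ξ_J`: the only nonzero values are
`ψ(1, ξ₁₂₃₄) = -2`, `ψ(ξ₁₂₃₄, 1) = 2` and `ψ(ξ_i, ξ_{{i}ᶜ}) = ψ(ξ_{{i}ᶜ}, ξ_i) = -∂ᵢ-sign`
(equivalently `ψ(ξ_i, ∂ᵢξ₁₂₃₄) = -1`). -/
def psi0 (I J : Idx) : ℂ :=
  (if I = (∅ : Idx) ∧ J = (Finset.univ : Idx) then (-2 : ℂ) else 0)
  + (if I = (Finset.univ : Idx) ∧ J = (∅ : Idx) then (2 : ℂ) else 0)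
  + ∑ i : Fin 4, (if I = ({i} : Idx) ∧ J = ({i}ᶜ : Idx) then (-(dsign i Finset.univ) : ℂ) else 0)
  + ∑ i : Fin 4, (if I = ({i}ᶜ : Idx) ∧ J = ({i} : Idx) then (-(dsign i Finset.univ) : ℂ) else 0)

/-- The action on `Ind F` of the bracket `[t^m ξ_I, t^n ξ_J]` in `𝒜(K'₄) = K(1,4)₊ ⊕ ℂC`,
namely of
`(2n-2m-n|I|+m|J|) t^{m+n-1} ξ_{IJ} + (-1)^{|I|} t^{m+n} ∑ᵢ ∂ᵢξ_I ∂ᵢξ_J + ψ(t^mξ_I, t^nξ_J) C`,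
expressed through a family `act` of operators (the actions of the `t^m ξ_I`). -/
def brkAct (ρC : F →ₗ[ℂ] F) (act : ℕ → Idx → (VInd F →ₗ[ℂ] VInd F))
    (m : ℕ) (I : Idx) (n : ℕ) (J : Idx) : VInd F →ₗ[ℂ] VInd F :=
  ((2 * (n : ℤ) - 2 * (m : ℤ) - (n : ℤ) * I.card + (m : ℤ) * J.card : ℤ) : ℂ) •
      (if Disjoint I J then ((msign I J : ℤ) : ℂ) • act (m + n - 1) (I ∪ J) else 0)
  + ((-1 : ℂ) ^ I.card) • (∑ i : Fin 4,
      if i ∈ I ∧ i ∈ J ∧ Disjoint (I.erase i) (J.erase i) then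
        ((dsign i I * dsign i J * msign (I.erase i) (J.erase i) : ℤ) : ℂ) •
          act (m + n) (I.erase i ∪ J.erase i)
      else 0)
  + (if m = 0 ∧ n = 0 then psi0 I J else 0) • Cop ρC

/-- The data of a generalized Verma module over `𝒜(K'₄)`:
the action `ρt, ρC, ρξ i j` of the degree-zero part `𝔤₀ = ⟨C, t, ξ_{ij}⟩` on `F`,
and the action `act m I` of the basis elements `t^m ξ_I` of `K(1,4)₊` on
`Ind F = ℂ[Θ] ⊗ Λ(η) ⊗ F`. -/
structure VermaData (F : Type*) [AddCommGroup F] [Module ℂ F] where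
  ρt : F →ₗ[ℂ] F
  ρC : F →ₗ[ℂ] F
  ρξ : Fin 4 → Fin 4 → (F →ₗ[ℂ] F)
  act : ℕ → Idx → (VInd F →ₗ[ℂ] VInd F)

/-- The properties characterizing the generalized Verma module `Ind F` over `𝒜(K'₄)`:
* `anti` : `ξ_{ij} = -ξ_{ji}`;
* `lie`  : `act` is an action of the Lie superalgebra `𝒜(K'₄) = K(1,4)₊ ⊕ ℂC`
  (with `C` acting through `ρC`);
* `vac_pos` : the positive part `𝔤_{>0}` (spanned by the `t^m ξ_I` with `2m + |I| - 2 > 0`)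
  kills the vacuum subspace `1 ⊗ F`;
* `vac_xi`, `vac_t` : `𝔤₀` acts on `1 ⊗ F` through `ρξ`, `ρt`;
* `low_eta`, `low_one` : the negative part acts by left multiplication in
  `U(𝔤_{<0}) = ℂ[Θ] ⊗ Λ(η₁,…,η₄)` (with `η_i² = Θ` and `ξ_∅ = -2Θ`). -/
structure IsVerma (D : VermaData F) : Prop where
  anti : ∀ i j, D.ρξ i j = - D.ρξ j i
  lie : ∀ (m : ℕ) (I : Idx) (n : ℕ) (J : Idx),
      D.act m I ∘ₗ D.act n J - ((-1 : ℂ) ^ (I.card * J.card)) • (D.act n J ∘ₗ D.act m I)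
        = brkAct D.ρC D.act m I n J
  vac_pos : ∀ (v : F) (m : ℕ) (I : Idx), 2 < 2 * m + I.card → D.act m I (bv 0 ∅ v) = 0
  vac_xi : ∀ (v : F) (i j : Fin 4), i < j →
      D.act 0 {i, j} (bv 0 ∅ v) = bv 0 ∅ (D.ρξ i j v)
  vac_t : ∀ v : F, D.act 1 ∅ (bv 0 ∅ v) = bv 0 ∅ (D.ρt v)
  low_eta : ∀ (v : F) (k : ℕ) (L : Idx) (i : Fin 4),
      D.act 0 {i} (bv k L v) =
        if i ∈ L then ((dsign i L : ℤ) : ℂ) • bv (k + 1) (L.erase i) v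
        else ((msign {i} L : ℤ) : ℂ) • bv k (insert i L) v
  low_one : ∀ (v : F) (k : ℕ) (L : Idx),
      D.act 0 ∅ (bv k L v) = (-2 : ℂ) • bv (k + 1) L v

/-- A (nonzero) singular vector: a nonzero vector killed by
`𝔤_{>0} = ⟨t^m ξ_I : 2m + |I| - 2 > 0⟩`. -/
def IsSingular (D : VermaData F) (u : VInd F) : Prop :=
  u ≠ 0 ∧ ∀ (m : ℕ) (I : Idx), 2 < 2 * m + I.card → D.act m I u = 0

/-- `u` is homogeneous of degree `d` (`Θ^k η_L ⊗ v` has degree `2k + |L|`). -/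
def HomogDeg (u : VInd F) (d : ℕ) : Prop := ∀ p ∈ u.support, 2 * p.1 + p.2.card = d

/-- `u` is a highest weight vector: it is killed by the positive root vectors
`e₁ = -ξ₁₃ + i ξ₂₃` and `e₂ = -ξ₂₄ - i ξ₁₄` of `𝔤₀` (0-indexed below). -/
def IsHW (D : VermaData F) (u : VInd F) : Prop :=
  Complex.I • D.act 0 {1, 2} u - D.act 0 {0, 2} u = 0 ∧
  -(D.act 0 {1, 3} u) - Complex.I • D.act 0 {0, 3} u = 0

/-- `e₁ = e_x + e_y = -ξ₁₃ + i ξ₂₃` acting on `F`. -/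
def e1F (D : VermaData F) : F →ₗ[ℂ] F := -(D.ρξ 0 2) + Complex.I • D.ρξ 1 2

/-- `e₂ = e_x - e_y = -ξ₂₄ - i ξ₁₄` acting on `F`. -/
def e2F (D : VermaData F) : F →ₗ[ℂ] F := -(D.ρξ 1 3) - Complex.I • D.ρξ 0 3

/-- `h_x = -iξ₁₂ + iξ₃₄` acting on `F`. -/
def hxF (D : VermaData F) : F →ₗ[ℂ] F := -(Complex.I • D.ρξ 0 1) + Complex.I • D.ρξ 2 3

/-- `h_y = -iξ₁₂ - iξ₃₄` acting on `F`. -/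
def hyF (D : VermaData F) : F →ₗ[ℂ] F := -(Complex.I • D.ρξ 0 1) - Complex.I • D.ρξ 2 3

/-- `f_x = (ξ₁₃ + ξ₂₄ - iξ₁₄ + iξ₂₃)/2` acting on `F`. -/
def fxF (D : VermaData F) : F →ₗ[ℂ] F :=
  (2 : ℂ)⁻¹ • (D.ρξ 0 2 + D.ρξ 1 3 - Complex.I • D.ρξ 0 3 + Complex.I • D.ρξ 1 2)

/-- `f_y = (ξ₁₃ - ξ₂₄ + iξ₁₄ + iξ₂₃)/2` acting on `F`. -/
def fyF (D : VermaData F) : F →ₗ[ℂ] F :=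
  (2 : ℂ)⁻¹ • (D.ρξ 0 2 - D.ρξ 1 3 + Complex.I • D.ρξ 0 3 + Complex.I • D.ρξ 1 2)

/-- `v` is a highest weight vector of `F` of weight `μ = (μ.1, μ.2.1, μ.2.2.1, μ.2.2.2)`
with respect to `(h_x, h_y, t, C)`. -/
def IsHWvec (D : VermaData F) (μ : ℂ × ℂ × ℂ × ℂ) (v : F) : Prop :=
  v ≠ 0 ∧ e1F D v = 0 ∧ e2F D v = 0 ∧ hxF D v = μ.1 • v ∧ hyF D v = μ.2.1 • v ∧
    D.ρt v = μ.2.2.1 • v ∧ D.ρC v = μ.2.2.2 • v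

/-- `F` is an irreducible `𝔤₀`-module. -/
def IsIrred (D : VermaData F) : Prop :=
  (∃ v : F, v ≠ 0) ∧ ∀ p : Submodule ℂ F,
    (∀ v ∈ p, D.ρt v ∈ p ∧ D.ρC v ∈ p ∧ ∀ i j, D.ρξ i j v ∈ p) → p = ⊥ ∨ p = ⊤

/-- The commutative-in-`Θ` algebra `U(𝔤_{<0}) = ℂ[Θ] ⊗ Λ(η₁,…,η₄)` (as a ℂ-module with
basis `Θ^k η_L`). -/
abbrev CA : Type := (ℕ × Idx) →₀ ℂ

/-- Multiplication in `U(𝔤_{<0})` (`η_i² = Θ`, `Θ` central, `η_i η_j = -η_j η_i`). -/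
def cmul (x y : CA) : CA :=
  x.sum fun p c => y.sum fun q c' =>
    Finsupp.single (p.1 + q.1 + (p.2 ∩ q.2).card, (p.2 \ q.2) ∪ (q.2 \ p.2))
      (c * c' * ((msign p.2 q.2 : ℤ) : ℂ))

/-- `w₁₁ = η₂ + i η₁`. -/
def w11 : CA := Finsupp.single (0, ({1} : Idx)) 1 + Complex.I • Finsupp.single (0, ({0} : Idx)) 1
/-- `w₂₂ = η₂ - i η₁`. -/
def w22 : CA := Finsupp.single (0, ({1} : Idx)) 1 - Complex.I • Finsupp.single (0, ({0} : Idx)) 1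
/-- `w₁₂ = -η₄ + i η₃`. -/
def w12 : CA := -Finsupp.single (0, ({3} : Idx)) 1 + Complex.I • Finsupp.single (0, ({2} : Idx)) 1
/-- `w₂₁ = η₄ + i η₃`. -/
def w21 : CA := Finsupp.single (0, ({3} : Idx)) 1 + Complex.I • Finsupp.single (0, ({2} : Idx)) 1

/-- `a ⊗ v ∈ U(𝔤_{<0}) ⊗ F = Ind F`. -/
def tens (a : CA) (v : F) : VInd F := a.sum fun p c => Finsupp.single p (c • v)

end


structure SlPair {F : Type*} [AddCommGroup F] [Module ℂ F]
    (ex fx hx ey fy hy : F →ₗ[ℂ] F) (wa wb : ℂ) (w : F) : Prop where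
  hex : ∀ v, hx (ex v) = ex (hx v) + (2 : ℂ) • ex v
  hfx : ∀ v, hx (fx v) = fx (hx v) - (2 : ℂ) • fx v
  efx : ∀ v, ex (fx v) = fx (ex v) + hx v
  hey : ∀ v, hy (ey v) = ey (hy v) + (2 : ℂ) • ey v
  hfy : ∀ v, hy (fy v) = fy (hy v) - (2 : ℂ) • fy v
  efy : ∀ v, ey (fy v) = fy (ey v) + hy v
  cee : ∀ v, ey (ex v) = ex (ey v)
  cef : ∀ v, ey (fx v) = fx (ey v)
  ceh : ∀ v, ey (hx v) = hx (ey v)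
  cfe : ∀ v, fy (ex v) = ex (fy v)
  cff : ∀ v, fy (fx v) = fx (fy v)
  cfh : ∀ v, fy (hx v) = hx (fy v)
  che : ∀ v, hy (ex v) = ex (hy v)
  chf : ∀ v, hy (fx v) = fx (hy v)
  chh : ∀ v, hy (hx v) = hx (hy v)
  irr : ∀ p : Submodule ℂ F, (∀ v ∈ p, ex v ∈ p ∧ fx v ∈ p ∧ hx v ∈ p ∧
    ey v ∈ p ∧ fy v ∈ p ∧ hy v ∈ p) → p = ⊥ ∨ p = ⊤
  w0 : w ≠ 0
  exw : ex w = 0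
  eyw : ey w = 0
  hxw : hx w = wa • w
  hyw : hy w = wb • w

namespace SlPair

variable {F : Type*} [AddCommGroup F] [Module ℂ F]
  {ex fx hx ey fy hy : F →ₗ[ℂ] F} {wa wb : ℂ} {w : F}

theorem swap (S : SlPair ex fx hx ey fy hy wa wb w) : SlPair ey fy hy ex fx hx wb wa w where
  hex := S.hey
  hfx := S.hfy
  efx := S.efy
  hey := S.hex
  hfy := S.hfx
  efy := S.efx
  cee v := (S.cee v).symm
  cef v := (S.cfe v).symm
  ceh v := (S.che v).symm
  cfe v := (S.cef v).symm
  cff v := (S.cff v).symm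
  cfh v := (S.chf v).symm
  che v := (S.ceh v).symm
  chf v := (S.cfh v).symm
  chh v := (S.chh v).symm
  irr p hp := S.irr p fun v hv => by
    obtain ⟨h1, h2, h3, h4, h5, h6⟩ := hp v hv
    exact ⟨h4, h5, h6, h1, h2, h3⟩
  w0 := S.w0
  exw := S.eyw
  eyw := S.exw
  hxw := S.hyw
  hyw := S.hxw

theorem top_of_mem (S : SlPair ex fx hx ey fy hy wa wb w) (p : Submodule ℂ F) (hw : w ∈ p)
    (hp : ∀ v ∈ p, ex v ∈ p ∧ fx v ∈ p ∧ hx v ∈ p ∧ ey v ∈ p ∧ fy v ∈ p ∧ hy v ∈ p) (v : F) :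
    v ∈ p := by
  rcases S.irr p hp with h | h
  · subst h
    exact absurd ((Submodule.mem_bot ℂ).1 hw) S.w0
  · rw [h]; trivial

theorem prim_nat [FiniteDimensional ℂ F] (S : SlPair ex fx hx ey fy hy wa wb w) {v : F} {κ : ℂ}
    (hv : v ≠ 0) (he : ex v = 0) (hh : hx v = κ • v) : ∃ n : ℕ, κ = n := by
  have hne : hx ≠ 0 ∨ hx = 0 := (em _).symm
  rcases hne with hne | h0
  · let _ : LieRing (Module.End ℂ F) := LieRing.ofAssociativeRing
    have T : @IsSl2Triple (Module.End ℂ F) _ hx ex fx := by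
      refine ⟨hne, ?_, ?_, ?_⟩
      · ext z; simp [Ring.lie_def, S.efx]
      · ext z; simp [Ring.lie_def, S.hex, two_smul]
      · ext z; simp [Ring.lie_def, S.hfx, two_smul]
    have P : T.HasPrimitiveVectorWith v κ := ⟨hv, by simpa using hh, by simpa using he⟩
    exact P.exists_nat
  · refine ⟨0, ?_⟩
    rw [h0] at hh
    have := (smul_eq_zero.1 hh.symm).resolve_right hv
    simpa using this

theorem wa_nat [FiniteDimensional ℂ F] (S : SlPair ex fx hx ey fy hy wa wb w) :
    ∃ n : ℕ, wa = n := S.prim_nat S.w0 S.exw S.hxw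

theorem casimir (S : SlPair ex fx hx ey fy hy wa wb w) (v : F) :
    (4 : ℂ) • fx (ex v) + hx (hx v) + (2 : ℂ) • hx v = (wa * (wa + 2)) • v := by
  let K : F →ₗ[ℂ] F := (4 : ℂ) • (fx ∘ₗ ex) + hx ∘ₗ hx + (2 : ℂ) • hx
    - (wa * (wa + 2)) • LinearMap.id
  have hK : ∀ z, K z = (4 : ℂ) • fx (ex z) + hx (hx z) + (2 : ℂ) • hx z - (wa * (wa + 2)) • z :=
    fun z => rfl
  have key : v ∈ LinearMap.ker K := by
    refine S.top_of_mem _ ?_ ?_ v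
    · rw [LinearMap.mem_ker, hK, S.exw, S.hxw, map_smul, S.hxw, map_zero]
      module
    · intro z hz
      have c1 : K (ex z) = ex (K z) := by
        simp only [hK, map_add, map_sub, map_smul, S.hex, S.efx]; module
      have c2 : K (fx z) = fx (K z) := by
        simp only [hK, map_add, map_sub, map_smul, S.hfx, S.efx]; module
      have c3 : K (hx z) = hx (K z) := by
        simp only [hK, map_add, map_sub, map_smul, S.hfx, S.hex]; module
      have c4 : K (ey z) = ey (K z) := by
        simp only [hK, map_add, map_sub, map_smul, S.cee, S.cef, S.ceh]
      have c5 : K (fy z) = fy (K z) := by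
        simp only [hK, map_add, map_sub, map_smul, S.cfe, S.cff, S.cfh]
      have c6 : K (hy z) = hy (K z) := by
        simp only [hK, map_add, map_sub, map_smul, S.che, S.chf, S.chh]
      rw [LinearMap.mem_ker] at hz
      simp only [LinearMap.mem_ker, c1, c2, c3, c4, c5, c6, hz, map_zero, and_self]
  rw [LinearMap.mem_ker, hK] at key
  exact sub_eq_zero.1 key

theorem ker_e [FiniteDimensional ℂ F] (S : SlPair ex fx hx ey fy hy wa wb w) {v : F}
    (he : ex v = 0) : hx v = wa • v := by
  by_contra hne
  obtain ⟨n, hn⟩ := S.wa_nat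
  have h1 : hx v - wa • v ≠ 0 := sub_ne_zero.2 hne
  have h2 : ex (hx v - wa • v) = 0 := by
    have := S.hex v
    rw [he] at this
    simp at this
    simp [he, ← this]
  have h3 : hx (hx v - wa • v) = (-(wa + 2)) • (hx v - wa • v) := by
    have := S.casimir v
    rw [he, map_zero] at this
    rw [map_sub, map_smul]
    linear_combination (norm := module) this
  obtain ⟨k, hk⟩ := S.prim_nat h1 h2 h3
  rw [hn] at hk
  have : ((n + 2 + k : ℕ) : ℂ) = 0 := by push_cast; linear_combination -hk
  have := Nat.cast_eq_zero.1 this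
  omega

theorem wa_add_one [FiniteDimensional ℂ F] (S : SlPair ex fx hx ey fy hy wa wb w) :
    wa + 1 ≠ 0 := by
  obtain ⟨n, hn⟩ := S.wa_nat
  rw [hn]; exact Nat.cast_add_one_ne_zero n

theorem e_zero [FiniteDimensional ℂ F] (S : SlPair ex fx hx ey fy hy wa wb w) (h : wa = 0)
    (v : F) : ex v = 0 := by
  have hfw : fx w = 0 := by
    have h1 : ex (fx w) = 0 := by rw [S.efx, S.exw, S.hxw, h]; simp
    have h2 := S.ker_e h1
    rw [S.hfx, S.hxw, h] at h2
    simpa using h2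
  have : v ∈ LinearMap.ker ex ⊓ LinearMap.ker fx ⊓ LinearMap.ker hx := by
    refine S.top_of_mem _ ?_ ?_ v
    · simp [hfw, S.exw, S.hxw, h]
    · intro z hz
      simp only [Submodule.mem_inf, LinearMap.mem_ker] at hz ⊢
      obtain ⟨⟨h1, h2⟩, h3⟩ := hz
      simp [h1, h2, h3, ← S.cee, ← S.cef, ← S.ceh, ← S.cfe, ← S.cff, ← S.cfh, ← S.che, ← S.chf,
        ← S.chh]
  simp only [Submodule.mem_inf, LinearMap.mem_ker] at this
  exact this.1.1

theorem pair_weight [FiniteDimensional ℂ F] (S : SlPair ex fx hx ey fy hy wa wb w) {L : ℂ}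
    {p q : F} (hq : q ≠ 0) (eq0 : ex q = 0) (ep : ex p = -q)
    (h : (2 : ℂ) • ex p - hx q = L • q) : L = -2 - wa ∧ wa ≠ 0 := by
  constructor
  · rw [ep, S.ker_e eq0] at h
    have : (L - (-2 - wa)) • q = 0 := by linear_combination (norm := module) -h
    exact sub_eq_zero.1 ((smul_eq_zero.1 this).resolve_right hq)
  · intro h0
    rw [S.e_zero h0] at ep
    exact hq (by simpa using ep.symm)

theorem pair_eq [FiniteDimensional ℂ F] (S : SlPair ex fx hx ey fy hy wa wb w) {L : ℂ}
    {p q : F} (hL : L = -2 - wa) (hwa : wa ≠ 0) (eq0 : ex q = 0) (ep : ex p = -q)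
    (h : (2 : ℂ) • fx q + hx p = L • p) : p = -(wa⁻¹ • fx q) := by
  have hq := S.ker_e eq0
  have h1 : ex (p + wa⁻¹ • fx q) = 0 := by
    rw [map_add, map_smul, S.efx, eq0, hq, ep, map_zero, zero_add, smul_smul,
      inv_mul_cancel₀ hwa]
    simp
  have h2 := S.ker_e h1
  rw [map_add, map_smul, S.hfx, hq, map_smul] at h2
  have h3 : (2 * (wa + 1)) • (p + wa⁻¹ • fx q) = 0 := by
    rw [hL] at h
    have e1 : (wa * wa⁻¹) • fx q = fx q := by rw [mul_inv_cancel₀ hwa, one_smul]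
    linear_combination (norm := module) h - h2 + (2:ℂ) • e1
  have h4 := (smul_eq_zero.1 h3).resolve_left (mul_ne_zero two_ne_zero S.wa_add_one)
  exact eq_neg_of_add_eq_zero_left h4

theorem pair_zero [FiniteDimensional ℂ F] (S : SlPair ex fx hx ey fy hy wa wb w) {L : ℂ}
    {p : F} (hp : p ≠ 0) (ep : ex p = 0) (h : hx p = L • p) : L = wa := by
  rw [S.ker_e ep] at h
  have : (wa - L) • p = 0 := by rw [sub_smul, h, sub_self]
  exact (sub_eq_zero.1 ((smul_eq_zero.1 this).resolve_right hp)).symm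

theorem hw_unique [FiniteDimensional ℂ F] (S : SlPair ex fx hx ey fy hy wa wb w) {v : F}
    (h1 : ex v = 0) (h2 : ey v = 0) : ∃ δ : ℂ, v = δ • w := by
  let g : ℕ → ℕ → F := fun i j => (fx ^ i) ((fy ^ j) w)
  have gx : ∀ i j, fx (g i j) = g (i + 1) j := fun i j => by
    simp only [g, pow_succ', Module.End.mul_apply]
  have g0y : ∀ j, fy (g 0 j) = g 0 (j + 1) := fun j => by
    simp only [g, pow_succ', Module.End.mul_apply, pow_zero, Module.End.one_apply]
  have gy : ∀ i j, fy (g i j) = g i (j + 1) := by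
    intro i
    induction i with
    | zero => exact g0y
    | succ i ih => intro j; rw [← gx, S.cff, ih, gx]
  have ghx0 : ∀ j, hx (g 0 j) = wa • g 0 j := by
    intro j
    induction j with
    | zero => simpa [g] using S.hxw
    | succ j ih => rw [← gy, ← S.cfh, ih, map_smul]
  have ghx : ∀ i j, hx (g i j) = (wa - 2 * i) • g i j := by
    intro i j
    induction i with
    | zero => rw [ghx0]; simp
    | succ i ih => rw [← gx, S.hfx, ih, map_smul]; push_cast; module
  have ghy0 : ∀ j, hy (g 0 j) = (wb - 2 * j) • g 0 j := by
    intro j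
    induction j with
    | zero => simpa [g] using S.hyw
    | succ j ih => rw [← gy, S.hfy, ih, map_smul]; push_cast; module
  have ghy : ∀ i j, hy (g i j) = (wb - 2 * j) • g i j := by
    intro i j
    induction i with
    | zero => exact ghy0 j
    | succ i ih => rw [← gx, S.chf, ih, map_smul]
  have gex0 : ∀ j, ex (g 0 j) = 0 := by
    intro j
    induction j with
    | zero => simpa [g] using S.exw
    | succ j ih => rw [← gy, ← S.cfe, ih, map_zero]
  have gey0 : ∀ j, ∃ r : ℂ, ∃ j', ey (g 0 j) = r • g 0 j' ∧ (r = 0 ∨ j' + 1 = j) := by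
    intro j
    induction j with
    | zero => exact ⟨0, 0, by simpa [g] using S.eyw, Or.inl rfl⟩
    | succ j ih =>
      obtain ⟨r, j', h, h'⟩ := ih
      rw [← gy, S.efy, h, map_smul, gy, ghy]
      rcases h' with rfl | rfl
      · exact ⟨_, j, by rw [zero_smul, zero_add], Or.inr rfl⟩
      · exact ⟨_, j' + 1, by rw [← add_smul], Or.inr rfl⟩
  have gey : ∀ i j, ∃ r : ℂ, ∃ j', ey (g i j) = r • g i j' := by
    intro i j
    induction i with
    | zero => obtain ⟨r, j', h, _⟩ := gey0 j; exact ⟨r, j', h⟩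
    | succ i ih =>
      obtain ⟨r, j', h⟩ := ih
      exact ⟨r, j', by rw [← gx, S.cef, h, map_smul, gx]⟩
  have gex : ∀ i j, ∃ r : ℂ, ∃ i', ex (g i j) = r • g i' j ∧ (r = 0 ∨ i' + 1 = i) := by
    intro i j
    induction i with
    | zero => exact ⟨0, 0, by rw [gex0, zero_smul], Or.inl rfl⟩
    | succ i ih =>
      obtain ⟨r, i', h, h'⟩ := ih
      rw [← gx, S.efx, h, map_smul, gx, ghx]
      rcases h' with rfl | rfl
      · exact ⟨_, i, by rw [zero_smul, zero_add], Or.inr rfl⟩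
      · exact ⟨_, i' + 1, by rw [← add_smul], Or.inr rfl⟩
  let p : Submodule ℂ F := Submodule.span ℂ (Set.range fun ij : ℕ × ℕ => g ij.1 ij.2)
  have gp : ∀ i j, g i j ∈ p := fun i j => Submodule.subset_span ⟨(i, j), rfl⟩
  have hcl : ∀ T : F →ₗ[ℂ] F, (∀ i j, T (g i j) ∈ p) → ∀ z ∈ p, T z ∈ p := by
    intro T hT z hz
    have : p ≤ p.comap T := by
      refine Submodule.span_le.2 ?_
      rintro _ ⟨⟨i, j⟩, rfl⟩
      exact hT i j
    exact this hz
  have hall : ∀ z, z ∈ p := by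
    refine S.top_of_mem p ?_ ?_
    · simpa [g] using gp 0 0
    · intro z hz
      refine ⟨hcl _ (fun i j => ?_) z hz, hcl _ (fun i j => ?_) z hz, hcl _ (fun i j => ?_) z hz,
        hcl _ (fun i j => ?_) z hz, hcl _ (fun i j => ?_) z hz, hcl _ (fun i j => ?_) z hz⟩
      · obtain ⟨r, i', h, _⟩ := gex i j
        rw [h]; exact p.smul_mem _ (gp _ _)
      · rw [gx]; exact gp _ _
      · rw [ghx]; exact p.smul_mem _ (gp _ _)
      · obtain ⟨r, i', h⟩ := gey i j
        rw [h]; exact p.smul_mem _ (gp _ _)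
      · rw [gy]; exact gp _ _
      · rw [ghy]; exact p.smul_mem _ (gp _ _)
  let H : Module.End ℂ F := hx + hy
  let Q : Submodule ℂ F := ⨆ κ, ⨆ (_ : κ ≠ wa + wb), H.eigenspace κ
  have hsub : p ≤ Submodule.span ℂ {w} ⊔ Q := by
    refine Submodule.span_le.2 ?_
    rintro _ ⟨⟨i, j⟩, rfl⟩
    by_cases hij : i + j = 0
    · obtain ⟨rfl, rfl⟩ : i = 0 ∧ j = 0 := by omega
      exact Submodule.mem_sup_left (by simp [g])
    · refine Submodule.mem_sup_right ?_
      have hne : (wa - 2 * i) + (wb - 2 * j) ≠ wa + wb := by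
        intro h
        have : ((i + j : ℕ) : ℂ) = 0 := by push_cast; linear_combination (-1/2) * h
        exact hij (Nat.cast_eq_zero.1 this)
      refine Submodule.mem_iSup_of_mem _ (Submodule.mem_iSup_of_mem hne ?_)
      rw [Module.End.mem_eigenspace_iff]
      change hx (g i j) + hy (g i j) = _
      rw [ghx, ghy, add_smul]
  obtain ⟨a, ha, b, hb, hab⟩ := Submodule.mem_sup.1 (hsub (hall v))
  obtain ⟨δ, rfl⟩ := Submodule.mem_span_singleton.1 ha
  refine ⟨δ, ?_⟩
  have hbE : b ∈ H.eigenspace (wa + wb) := by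
    rw [Module.End.mem_eigenspace_iff]
    change hx b + hy b = _
    have : b = v - δ • w := by rw [← hab]; abel
    rw [S.ker_e (v := b) (by rw [this, map_sub, map_smul, h1, S.exw]; simp),
      S.swap.ker_e (v := b) (by rw [this, map_sub, map_smul, h2, S.eyw]; simp), add_smul]
  have hb0 : b = 0 := by
    have := (Module.End.eigenspaces_iSupIndep H) (wa + wb)
    exact Submodule.disjoint_def.1 this b hbE hb
  rw [← hab, hb0, add_zero]

end SlPair

/-- Equations on one doublet `w₁ ⊗ p + w₂ ⊗ q`. -/
structure PairEqs {F : Type*} [AddCommGroup F] [Module ℂ F] (e f h : F →ₗ[ℂ] F) (L : ℂ)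
    (p q : F) : Prop where
  eq0 : e q = 0
  ep : e p = -q
  up : (2 : ℂ) • f q + h p = L • p
  dn : (2 : ℂ) • e p - h q = L • q

theorem PairEqs.zero {F : Type*} [AddCommGroup F] [Module ℂ F] (e f h : F →ₗ[ℂ] F) (L : ℂ) :
    PairEqs e f h L 0 0 := ⟨by simp, by simp, by simp, by simp⟩

namespace SlPair

variable {F : Type*} [AddCommGroup F] [Module ℂ F] [FiniteDimensional ℂ F]
  {ex fx hx ey fy hy : F →ₗ[ℂ] F} {wa wb : ℂ} {w : F}

theorem pairEqs_top (S : SlPair ex fx hx ey fy hy wa wb w) {p : F} (hp : ex p = 0) :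
    PairEqs ex fx hx wa p 0 :=
  ⟨by simp, by simp [hp], by simp [S.ker_e hp], by simp [hp]⟩

theorem pairEqs_low (S : SlPair ex fx hx ey fy hy wa wb w) (hwa : wa ≠ 0) {q : F}
    (hq : ex q = 0) : PairEqs ex fx hx (-2 - wa) (-(wa⁻¹ • fx q)) q := by
  have ep : ex (-(wa⁻¹ • fx q)) = -q := by
    rw [map_neg, map_smul, S.efx, hq, S.ker_e hq, map_zero, zero_add, smul_smul,
      inv_mul_cancel₀ hwa, one_smul]
  refine ⟨hq, ep, ?_, ?_⟩
  · rw [map_neg, map_smul, S.hfx, S.ker_e hq, map_smul]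
    have e1 : (wa * wa⁻¹) • fx q = fx q := by rw [mul_inv_cancel₀ hwa, one_smul]
    linear_combination (norm := module) -(2:ℂ) • e1
  · rw [ep, S.ker_e hq]; module

theorem classify (S : SlPair ex fx hx ey fy hy wa wb w) (Lx Ly : ℂ) (a b c d : F) :
    (¬ (a = 0 ∧ b = 0 ∧ c = 0 ∧ d = 0) ∧
      PairEqs ex fx hx Lx a c ∧ PairEqs ex fx hx Lx b d ∧
      PairEqs ey fy hy Ly a b ∧ PairEqs ey fy hy Ly c d) ↔
    ∃ r : ℂ, r ≠ 0 ∧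
      ((Lx = wa ∧ Ly = wb ∧ a = r • w ∧ b = 0 ∧ c = 0 ∧ d = 0) ∨
       (wa ≠ 0 ∧ Lx = -2 - wa ∧ Ly = wb ∧ a = r • -(wa⁻¹ • fx w) ∧ b = 0 ∧ c = r • w ∧ d = 0) ∨
       (wa ≠ 0 ∧ wb ≠ 0 ∧ Lx = -2 - wa ∧ Ly = -2 - wb ∧ a = r • ((wa * wb)⁻¹ • fx (fy w)) ∧
          b = r • -(wa⁻¹ • fx w) ∧ c = r • -(wb⁻¹ • fy w) ∧ d = r • w) ∨
       (wb ≠ 0 ∧ Lx = wa ∧ Ly = -2 - wb ∧ a = r • -(wb⁻¹ • fy w) ∧ b = r • w ∧ c = 0 ∧ d = 0)) := by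
  have T := S.swap
  have two : (2 : ℂ) ≠ 0 := two_ne_zero
  have nx : (-2 - wa) ≠ wa := fun h => S.wa_add_one (by linear_combination (-1/2) * h)
  have ny : (-2 - wb) ≠ wb := fun h => T.wa_add_one (by linear_combination (-1/2) * h)
  constructor
  · rintro ⟨hne, X1, X2, Y1, Y2⟩
    by_cases hd : d = 0
    · subst hd
      by_cases hc : c = 0
      · subst hc
        by_cases hb : b = 0
        · subst hb
          have ha : a ≠ 0 := fun h => hne ⟨h, rfl, rfl, rfl⟩
          have e1 : ex a = 0 := by simpa using X1.ep
          have e2 : ey a = 0 := by simpa using Y1.ep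
          obtain ⟨r, rfl⟩ := S.hw_unique e1 e2
          exact ⟨r, fun h => ha (by rw [h, zero_smul]), Or.inl
            ⟨S.pair_zero ha e1 (by simpa using X1.up), T.pair_zero ha e2 (by simpa using Y1.up),
              rfl, rfl, rfl, rfl⟩⟩
        · have e1 : ex b = 0 := by simpa using X2.ep
          obtain ⟨hL, hwb⟩ := T.pair_weight hb Y1.eq0 Y1.ep Y1.dn
          have hLx := S.pair_zero hb e1 (by simpa using X2.up)
          have ha := T.pair_eq hL hwb Y1.eq0 Y1.ep Y1.up
          obtain ⟨r, rfl⟩ := S.hw_unique e1 Y1.eq0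
          refine ⟨r, fun h => hb (by rw [h, zero_smul]), Or.inr (Or.inr (Or.inr
            ⟨hwb, hLx, hL, ?_, rfl, rfl, rfl⟩))⟩
          rw [ha, map_smul]; module
      · have e1 : ey c = 0 := by simpa using Y2.ep
        obtain ⟨hL, hwa⟩ := S.pair_weight hc X1.eq0 X1.ep X1.dn
        have hLy := T.pair_zero hc e1 (by simpa using Y2.up)
        have ha := S.pair_eq hL hwa X1.eq0 X1.ep X1.up
        have hb : b = 0 := by
          by_contra hb
          exact nx (hL.symm.trans
            (S.pair_zero hb (by simpa using X2.ep) (by simpa using X2.up)))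
        obtain ⟨r, rfl⟩ := S.hw_unique X1.eq0 e1
        refine ⟨r, fun h => hc (by rw [h, zero_smul]), Or.inr (Or.inl
            ⟨hwa, hL, hLy, ?_, hb, rfl, rfl⟩)⟩
        rw [ha, map_smul]; module
    · obtain ⟨hLx, hwa⟩ := S.pair_weight hd X2.eq0 X2.ep X2.dn
      obtain ⟨hLy, hwb⟩ := T.pair_weight hd Y2.eq0 Y2.ep Y2.dn
      have hb := S.pair_eq hLx hwa X2.eq0 X2.ep X2.up
      have hc := T.pair_eq hLy hwb Y2.eq0 Y2.ep Y2.up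
      have ha := S.pair_eq hLx hwa X1.eq0 X1.ep X1.up
      obtain ⟨r, rfl⟩ := S.hw_unique X2.eq0 Y2.eq0
      refine ⟨r, fun h => hd (by rw [h, zero_smul]), Or.inr (Or.inr (Or.inl
            ⟨hwa, hwb, hLx, hLy, ?_, ?_, ?_, rfl⟩))⟩
      · rw [ha, hc]; simp only [map_smul, map_neg, mul_inv]; module
      · rw [hb, map_smul]; module
      · rw [hc, map_smul]; module
  · rintro ⟨r, hr, h⟩
    have rw0 : r • w ≠ 0 := smul_ne_zero hr S.w0
    have ex0 : ex (r • w) = 0 := by rw [map_smul, S.exw, smul_zero]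
    have ey0 : ey (r • w) = 0 := by rw [map_smul, S.eyw, smul_zero]
    rcases h with ⟨rfl, rfl, rfl, rfl, rfl, rfl⟩ | ⟨hwa, rfl, rfl, rfl, rfl, rfl, rfl⟩ |
      ⟨hwa, hwb, rfl, rfl, rfl, rfl, rfl, rfl⟩ | ⟨hwb, rfl, rfl, rfl, rfl, rfl, rfl⟩
    · exact ⟨fun h => rw0 h.1, S.pairEqs_top ex0, PairEqs.zero _ _ _ _, T.pairEqs_top ey0, PairEqs.zero _ _ _ _⟩
    · have ha : r • -(wa⁻¹ • fx w) = -(wa⁻¹ • fx (r • w)) := by rw [map_smul]; module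
      refine ⟨fun h => rw0 h.2.2.1, ?_, PairEqs.zero _ _ _ _, ?_,
        T.pairEqs_top ey0⟩
      · rw [ha]; exact S.pairEqs_low hwa ex0
      · refine T.pairEqs_top ?_
        rw [ha, map_neg, map_smul, S.cef, ey0]; simp
    · have hb : r • -(wa⁻¹ • fx w) = -(wa⁻¹ • fx (r • w)) := by rw [map_smul]; module
      have hc : r • -(wb⁻¹ • fy w) = -(wb⁻¹ • fy (r • w)) := by rw [map_smul]; module
      have ha : r • ((wa * wb)⁻¹ • fx (fy w)) = -(wa⁻¹ • fx (-(wb⁻¹ • fy (r • w)))) := by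
        simp only [map_smul, map_neg, mul_inv]; module
      have ha' : r • ((wa * wb)⁻¹ • fx (fy w)) = -(wb⁻¹ • fy (-(wa⁻¹ • fx (r • w)))) := by
        simp only [map_smul, map_neg, mul_inv, S.cff]; module
      refine ⟨fun h => rw0 h.2.2.2, ?_, ?_, ?_, ?_⟩
      · rw [ha, hc]
        refine S.pairEqs_low hwa ?_
        rw [map_neg, map_smul, ← S.cfe, ex0]; simp
      · rw [hb]; exact S.pairEqs_low hwa ex0
      · rw [ha', hb]
        refine T.pairEqs_low hwb ?_
        rw [map_neg, map_smul, S.cef, ey0]; simp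
      · rw [hc]; exact T.pairEqs_low hwb ey0
    · have ha : r • -(wb⁻¹ • fy w) = -(wb⁻¹ • fy (r • w)) := by rw [map_smul]; module
      refine ⟨fun h => rw0 h.2.1, ?_, S.pairEqs_top ex0, ?_, PairEqs.zero _ _ _ _⟩
      · refine S.pairEqs_top ?_
        rw [ha, map_neg, map_smul, ← S.cfe, ex0]; simp
      · rw [ha]; exact T.pairEqs_low hwb ey0

end SlPair

section Concrete

variable {F : Type*} [AddCommGroup F] [Module ℂ F]

theorem dsign_self (l : Fin 4) : dsign l {l} = 1 := by revert l; decide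

theorem msign_lt (i j : Fin 4) (h : i < j) : msign {i} {j} = 1 := by revert i j; decide

theorem msign_gt (i j : Fin 4) (h : j < i) : msign {i} {j} = -1 := by revert i j; decide

theorem eta_vac {D : VermaData F} (hD : IsVerma D) (l : Fin 4) (v : F) :
    D.act 0 {l} (bv 0 ∅ v) = bv 0 {l} v := by
  rw [hD.low_eta]
  simp [msign]

theorem lie_apply' {D : VermaData F} (hD : IsVerma D) (m : ℕ) (I : Idx) (n : ℕ) (J : Idx)
    (z : VInd F) :
    D.act m I (D.act n J z) = ((-1 : ℂ) ^ (I.card * J.card)) • D.act n J (D.act m I z)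
      + brkAct D.ρC D.act m I n J z := by
  have := LinearMap.congr_fun (hD.lie m I n J) z
  simp only [LinearMap.sub_apply, LinearMap.smul_apply, LinearMap.comp_apply] at this
  rw [← this]; abel

theorem Cop_vac (ρC : F →ₗ[ℂ] F) (v : F) : Cop ρC (bv 0 ∅ v) = bv 0 ∅ (ρC v) := by
  simp [Cop, bv]

/-- Bracket with a generator `ξ_l`. -/
theorem brk_eta (D : VermaData F) (m : ℕ) (I : Idx) (l : Fin 4) :
    brkAct D.ρC D.act m I 0 {l} =
      (-(m : ℂ)) • (if l ∈ I then 0 else ((msign I {l} : ℤ) : ℂ) • D.act (m - 1) (I ∪ {l}))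
      + ((-1 : ℂ) ^ I.card) • (if l ∈ I then ((dsign l I : ℤ) : ℂ) • D.act m (I.erase l) else 0)
      + (if m = 0 then psi0 I {l} else 0) • Cop D.ρC := by
  unfold brkAct
  congr 1
  · congr 1
    · congr 1
      · push_cast; simp; ring
      · simp only [Finset.disjoint_singleton_right, ite_not, add_zero]
    · congr 1
      rw [Finset.sum_eq_single l]
      · simp [dsign_self, msign]
      · intro b _ hb
        simp [hb]
      · simp
  · simp

theorem psi0_eta_of_card (I : Idx) (l : Fin 4) (h : I.card ≠ 3) : psi0 I {l} = 0 := by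
  have h1 : ∀ i : Fin 4, I ≠ ({i} : Idx)ᶜ := by
    rintro i rfl
    revert h; revert i; decide
  have h2 : ∀ i : Fin 4, ({l} : Idx) ≠ ({i} : Idx)ᶜ := by
    revert l; decide
  have h3 : ({l} : Idx) ≠ Finset.univ := by revert l; decide
  simp [psi0, h1, h2, h3]

theorem psi0_compl_eta (k l : Fin 4) :
    psi0 ({k}ᶜ) {l} = if k = l then (-(dsign k Finset.univ) : ℂ) else 0 := by
  have h0 : ({l} : Idx) ≠ Finset.univ := by revert l; decide
  have h1 : ∀ i : Fin 4, ({k} : Idx)ᶜ ≠ {i} := by revert k; decide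
  have h2 : ∀ i : Fin 4, (({k} : Idx)ᶜ = ({i} : Idx)ᶜ ∧ ({l} : Idx) = {i}) ↔ (k = i ∧ l = i) := by
    intro i; simp [compl_inj_iff]
  unfold psi0
  simp only [h2]
  simp only [h0, h1, and_false, false_and, if_false, Finset.sum_const_zero, zero_add,
    Finset.singleton_ne_empty]
  rw [Finset.sum_eq_single k]
  · simp [eq_comm]
  · intro b _ hb; simp [hb.symm]
  · simp

theorem psi0_two (I J : Idx) (h : I.card = 2) : psi0 I J = 0 := by
  have h0 : I ≠ ∅ := by rintro rfl; simp at h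
  have h3 : I ≠ Finset.univ := by rintro rfl; simp at h
  have h1 : ∀ i : Fin 4, I ≠ {i} := by rintro i rfl; simp at h
  have h2 : ∀ i : Fin 4, I ≠ ({i} : Idx)ᶜ := by
    rintro i rfl; revert h; revert i; decide
  simp [psi0, h0, h1, h2, h3]

theorem pos_eta {D : VermaData F} (hD : IsVerma D) (m : ℕ) (I : Idx) (h : 2 < 2 * m + I.card)
    (l : Fin 4) (v : F) :
    D.act m I (bv 0 {l} v) = brkAct D.ρC D.act m I 0 {l} (bv 0 ∅ v) := by
  rw [← eta_vac hD, lie_apply' hD, hD.vac_pos v m I h]; simp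

/-- Elements of degree at least two kill vectors of degree one. -/
theorem pos_eta_ge {D : VermaData F} (hD : IsVerma D) (m : ℕ) (I : Idx) (h : 3 < 2 * m + I.card)
    (l : Fin 4) (v : F) : D.act m I (bv 0 {l} v) = 0 := by
  rw [pos_eta hD m I (by omega), brk_eta]
  have a1 : (-(m : ℂ)) • (if l ∈ I then 0 else
      ((msign I {l} : ℤ) : ℂ) • D.act (m - 1) (I ∪ {l})) (bv 0 ∅ v) = 0 := by
    by_cases hm : m = 0
    · simp [hm]
    · by_cases hl : l ∈ I
      · simp [hl]
      · have : (I ∪ {l}).card = I.card + 1 := by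
          rw [Finset.card_union_of_disjoint (by simpa using hl)]; simp
        simp only [hl, if_false, LinearMap.smul_apply]
        rw [hD.vac_pos v (m - 1) _ (by omega)]; simp
  have a2 : (if l ∈ I then ((dsign l I : ℤ) : ℂ) • D.act m (I.erase l) else 0) (bv 0 ∅ v) = 0 := by
    by_cases hl : l ∈ I
    · have := Finset.card_erase_of_mem hl
      simp only [hl, if_true, LinearMap.smul_apply]
      rw [hD.vac_pos v m _ (by omega)]; simp
    · simp [hl]
  have a3 : (if m = 0 then psi0 I {l} else 0) = 0 := by
    split_ifs with hm
    · exact psi0_eta_of_card I l (by omega)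
    · rfl
  rw [LinearMap.add_apply, LinearMap.add_apply, LinearMap.smul_apply, LinearMap.smul_apply,
    LinearMap.smul_apply, a1, a2, a3]
  simp

theorem rho_diag {D : VermaData F} (hD : IsVerma D) (i : Fin 4) : D.ρξ i i = 0 := by
  have := hD.anti i i
  ext v
  have h2 : (2 : ℂ) • D.ρξ i i v = 0 := by
    have h3 := LinearMap.congr_fun this v
    rw [LinearMap.neg_apply] at h3
    rw [two_smul]
    nth_rewrite 1 [h3]
    simp
  simpa using h2

theorem xi_vac {D : VermaData F} (hD : IsVerma D) (i j : Fin 4) (hij : i ≠ j) (v : F) :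
    ((msign {i} {j} : ℤ) : ℂ) • D.act 0 ({i} ∪ {j}) (bv 0 ∅ v) = bv 0 ∅ (D.ρξ i j v) := by
  rcases lt_or_gt_of_ne hij with h | h
  · have : msign {i} {j} = 1 := msign_lt i j h
    rw [this, ← hD.vac_xi v i j h]
    simp
  · have : msign {i} {j} = -1 := msign_gt i j h
    rw [this, Finset.union_comm, hD.anti i j, LinearMap.neg_apply,
      show bv 0 ∅ (-(D.ρξ j i v)) = - bv 0 ∅ (D.ρξ j i v) by simp [bv],
      ← hD.vac_xi v j i h]
    simp

theorem txi_eta {D : VermaData F} (hD : IsVerma D) (i l : Fin 4) (v : F) :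
    D.act 1 {i} (bv 0 {l} v) =
      - bv 0 ∅ (D.ρξ i l v) - (if i = l then bv 0 ∅ (D.ρt v) else 0) := by
  rw [pos_eta hD 1 {i} (by simp), brk_eta]
  by_cases h : i = l
  · subst h
    have := hD.vac_t v
    simp [rho_diag hD, dsign_self, this]
    simp [bv]
  · have h' : l ≠ i := fun e => h e.symm
    have := xi_vac hD i l h v
    simp only [Finset.mem_singleton, h, h', if_false]
    simp only [LinearMap.add_apply, LinearMap.smul_apply, tsub_self, this]
    simp

theorem xi3_eta {D : VermaData F} (hD : IsVerma D) (k l : Fin 4) (v : F) :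
    D.act 0 ({k}ᶜ) (bv 0 {l} v) =
      if k = l then (-(dsign k Finset.univ) : ℂ) • bv 0 ∅ (D.ρC v)
      else - ((dsign l ({k}ᶜ) : ℤ) : ℂ) • D.act 0 (({k}ᶜ : Idx).erase l) (bv 0 ∅ v) := by
  have hc : ({k}ᶜ : Idx).card = 3 := by revert k; decide
  rw [pos_eta hD 0 _ (by rw [hc]; norm_num), brk_eta, psi0_compl_eta, hc]
  by_cases h : k = l
  · subst h
    simp [Cop_vac]
  · have h' : l ≠ k := fun e => h e.symm
    simp [h, h']
    norm_num

theorem xi2_eta {D : VermaData F} (hD : IsVerma D) (I : Idx) (hI : I.card = 2) (l : Fin 4)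
    (v w : F) (hw : D.act 0 I (bv 0 ∅ v) = bv 0 ∅ w) :
    D.act 0 I (bv 0 {l} v) = bv 0 {l} w +
      if l ∈ I then ((dsign l I : ℤ) : ℂ) • D.act 0 (I.erase l) (bv 0 ∅ v) else 0 := by
  rw [← eta_vac hD, lie_apply' hD, hw, brk_eta, psi0_two _ _ hI, hI, eta_vac hD]
  split_ifs <;> simp

/-- Commutator of two elements of degree zero. -/
theorem xi_comm {D : VermaData F} (hD : IsVerma D) (i j k l : Fin 4) (hij : i < j) (hkl : k < l)
    (v w : F) (h : (∑ a : Fin 4,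
      if a ∈ ({i, j} : Idx) ∧ a ∈ ({k, l} : Idx) ∧
          Disjoint (({i, j} : Idx).erase a) (({k, l} : Idx).erase a) then
        ((dsign a {i, j} * dsign a {k, l} *
          msign (({i, j} : Idx).erase a) (({k, l} : Idx).erase a) : ℤ) : ℂ) •
          D.act 0 (({i, j} : Idx).erase a ∪ ({k, l} : Idx).erase a)
      else 0) (bv 0 ∅ v) = bv 0 ∅ w) :
    D.ρξ i j (D.ρξ k l v) = D.ρξ k l (D.ρξ i j v) + w := by
  have hI : ({i, j} : Idx).card = 2 := Finset.card_pair hij.ne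
  have hJ : ({k, l} : Idx).card = 2 := Finset.card_pair hkl.ne
  have := lie_apply' hD 0 {i, j} 0 {k, l} (bv 0 ∅ v)
  rw [hD.vac_xi _ _ _ hkl, hD.vac_xi _ _ _ hij, hD.vac_xi _ _ _ hij, hD.vac_xi _ _ _ hkl, hI, hJ]
    at this
  unfold brkAct at this
  rw [LinearMap.add_apply, LinearMap.add_apply, LinearMap.smul_apply, LinearMap.smul_apply,
    LinearMap.smul_apply, psi0_two _ _ hI, hI, hJ, add_zero, h] at this
  have h2 : bv 0 ∅ (D.ρξ i j (D.ρξ k l v)) = bv 0 ∅ (D.ρξ k l (D.ρξ i j v) + w) := by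
    rw [this]; simp [bv]; norm_num
  exact Finsupp.single_injective _ h2

theorem xi_comm_zero {D : VermaData F} (hD : IsVerma D) (i j k l : Fin 4) (hij : i < j)
    (hkl : k < l) (hd : ∀ a : Fin 4, ¬ (a ∈ ({i, j} : Idx) ∧ a ∈ ({k, l} : Idx) ∧
          Disjoint (({i, j} : Idx).erase a) (({k, l} : Idx).erase a))) (v : F) :
    D.ρξ i j (D.ρξ k l v) = D.ρξ k l (D.ρξ i j v) := by
  have := xi_comm hD i j k l hij hkl v 0 (by
    rw [Finset.sum_eq_zero (fun a _ => if_neg (hd a))]; simp [bv])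
  simpa using this

theorem xi_comm_one {D : VermaData F} (hD : IsVerma D) (i j k l a p q : Fin 4) (s : ℤ)
    (hij : i < j) (hkl : k < l) (hpq : p < q)
    (hd : ∀ b : Fin 4, (b ∈ ({i, j} : Idx) ∧ b ∈ ({k, l} : Idx) ∧
          Disjoint (({i, j} : Idx).erase b) (({k, l} : Idx).erase b)) ↔ b = a)
    (hs : dsign a {i, j} * dsign a {k, l} *
          msign (({i, j} : Idx).erase a) (({k, l} : Idx).erase a) = s)
    (hu : ({i, j} : Idx).erase a ∪ ({k, l} : Idx).erase a = {p, q}) (v : F) :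
    D.ρξ i j (D.ρξ k l v) = D.ρξ k l (D.ρξ i j v) + (s : ℂ) • D.ρξ p q v := by
  refine xi_comm hD i j k l hij hkl v _ ?_
  rw [Finset.sum_eq_single a, if_pos ((hd a).2 rfl), hs, hu, LinearMap.smul_apply,
    hD.vac_xi v p q hpq]
  · simp [bv]
  · intro b _ hb
    exact if_neg (fun h => hb ((hd b).1 h))
  · simp

theorem t_comm {D : VermaData F} (hD : IsVerma D) (i j : Fin 4) (hij : i < j) (v : F) :
    D.ρξ i j (D.ρt v) = D.ρt (D.ρξ i j v) := by
  have hI : ({i, j} : Idx).card = 2 := Finset.card_pair hij.ne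
  have := lie_apply' hD 0 {i, j} 1 ∅ (bv 0 ∅ v)
  rw [hD.vac_t, hD.vac_xi _ _ _ hij, hD.vac_xi _ _ _ hij, hD.vac_t] at this
  unfold brkAct at this
  simp [hI] at this
  exact Finsupp.single_injective _ this

theorem brk_compl_zero : ∀ (i j l a : Fin 4), i < j → l ≠ i → l ≠ j →
    ¬ (a ∈ ({i, j} : Idx) ∧ a ∈ ({l}ᶜ : Idx) ∧
      Disjoint (({i, j} : Idx).erase a) (({l}ᶜ : Idx).erase a)) := by decide

theorem c_comm {D : VermaData F} (hD : IsVerma D) (i j : Fin 4) (hij : i < j) (v : F) :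
    D.ρξ i j (D.ρC v) = D.ρC (D.ρξ i j v) := by
  have hI : ({i, j} : Idx).card = 2 := Finset.card_pair hij.ne
  obtain ⟨l, hli, hlj⟩ : ∃ l : Fin 4, l ≠ i ∧ l ≠ j := by revert i j; decide
  have := lie_apply' hD 0 {i, j} 0 ({l}ᶜ) (bv 0 {l} v)
  rw [xi3_eta hD, xi2_eta hD {i, j} hI l v _ (hD.vac_xi v i j hij)] at this
  have hl : l ∉ ({i, j} : Idx) := by simp [hli, hlj]
  rw [if_neg hl, add_zero, xi3_eta hD, if_pos rfl, if_pos rfl, map_smul, hD.vac_xi _ _ _ hij, hI]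
    at this
  unfold brkAct at this
  rw [Finset.sum_eq_zero (fun a _ => if_neg (brk_compl_zero i j l a hij hli hlj)),
    psi0_two _ _ hI] at this
  simp [pow_mul] at this
  have hs : dsign l Finset.univ ≠ 0 := by simp [dsign]
  have h2 := smul_right_injective (VInd F) (r := ((dsign l Finset.univ : ℤ) : ℂ))
    (by exact_mod_cast hs) this
  exact Finsupp.single_injective _ h2

end Concrete

section Final

variable {F : Type*} [AddCommGroup F] [Module ℂ F]

noncomputable def exF (D : VermaData F) : F →ₗ[ℂ] F := (2 : ℂ)⁻¹ • (e1F D + e2F D)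

noncomputable def eyF (D : VermaData F) : F →ₗ[ℂ] F := (2 : ℂ)⁻¹ • (e1F D - e2F D)

theorem eX (D : VermaData F) (v : F) : exF D v = (2 : ℂ)⁻¹ •
    (-(D.ρξ 0 2 v) + Complex.I • D.ρξ 1 2 v - D.ρξ 1 3 v - Complex.I • D.ρξ 0 3 v) := by
  simp [exF, e1F, e2F]; module

theorem eY (D : VermaData F) (v : F) : eyF D v = (2 : ℂ)⁻¹ •
    (-(D.ρξ 0 2 v) + Complex.I • D.ρξ 1 2 v + D.ρξ 1 3 v + Complex.I • D.ρξ 0 3 v) := by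
  simp [eyF, e1F, e2F]; module

theorem fX (D : VermaData F) (v : F) : fxF D v = (2 : ℂ)⁻¹ •
    (D.ρξ 0 2 v + D.ρξ 1 3 v - Complex.I • D.ρξ 0 3 v + Complex.I • D.ρξ 1 2 v) := rfl

theorem fY (D : VermaData F) (v : F) : fyF D v = (2 : ℂ)⁻¹ •
    (D.ρξ 0 2 v - D.ρξ 1 3 v + Complex.I • D.ρξ 0 3 v + Complex.I • D.ρξ 1 2 v) := rfl

theorem hX (D : VermaData F) (v : F) :
    hxF D v = -(Complex.I • D.ρξ 0 1 v) + Complex.I • D.ρξ 2 3 v := rfl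

theorem hY (D : VermaData F) (v : F) :
    hyF D v = -(Complex.I • D.ρξ 0 1 v) - Complex.I • D.ρξ 2 3 v := rfl

theorem sl_relations {D : VermaData F} (hD : IsVerma D) :
    (∀ v, hxF D (exF D v) = exF D (hxF D v) + (2 : ℂ) • exF D v) ∧
    (∀ v, hxF D (fxF D v) = fxF D (hxF D v) - (2 : ℂ) • fxF D v) ∧
    (∀ v, exF D (fxF D v) = fxF D (exF D v) + hxF D v) ∧
    (∀ v, hyF D (eyF D v) = eyF D (hyF D v) + (2 : ℂ) • eyF D v) ∧
    (∀ v, hyF D (fyF D v) = fyF D (hyF D v) - (2 : ℂ) • fyF D v) ∧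
    (∀ v, eyF D (fyF D v) = fyF D (eyF D v) + hyF D v) ∧
    (∀ v, eyF D (exF D v) = exF D (eyF D v)) ∧
    (∀ v, eyF D (fxF D v) = fxF D (eyF D v)) ∧
    (∀ v, eyF D (hxF D v) = hxF D (eyF D v)) ∧
    (∀ v, fyF D (exF D v) = exF D (fyF D v)) ∧
    (∀ v, fyF D (fxF D v) = fxF D (fyF D v)) ∧
    (∀ v, fyF D (hxF D v) = hxF D (fyF D v)) ∧
    (∀ v, hyF D (exF D v) = exF D (hyF D v)) ∧
    (∀ v, hyF D (fxF D v) = fxF D (hyF D v)) ∧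
    (∀ v, hyF D (hxF D v) = hxF D (hyF D v)) := by
  have r0201 := xi_comm_one hD 0 2 0 1 0 1 2 (-1) (by decide) (by decide) (by decide)
    (by decide) (by decide) (by decide)
  have r0301 := xi_comm_one hD 0 3 0 1 0 1 3 (-1) (by decide) (by decide) (by decide)
    (by decide) (by decide) (by decide)
  have r0302 := xi_comm_one hD 0 3 0 2 0 2 3 (-1) (by decide) (by decide) (by decide)
    (by decide) (by decide) (by decide)
  have r1201 := xi_comm_one hD 1 2 0 1 1 0 2 (1) (by decide) (by decide) (by decide)
    (by decide) (by decide) (by decide)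
  have r1202 := xi_comm_one hD 1 2 0 2 2 0 1 (-1) (by decide) (by decide) (by decide)
    (by decide) (by decide) (by decide)
  have r1203 := xi_comm_zero hD 1 2 0 3 (by decide) (by decide) (by decide)
  have r1301 := xi_comm_one hD 1 3 0 1 1 0 3 (1) (by decide) (by decide) (by decide)
    (by decide) (by decide) (by decide)
  have r1302 := xi_comm_zero hD 1 3 0 2 (by decide) (by decide) (by decide)
  have r1303 := xi_comm_one hD 1 3 0 3 3 0 1 (-1) (by decide) (by decide) (by decide)
    (by decide) (by decide) (by decide)
  have r1312 := xi_comm_one hD 1 3 1 2 1 2 3 (-1) (by decide) (by decide) (by decide)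
    (by decide) (by decide) (by decide)
  have r2301 := xi_comm_zero hD 2 3 0 1 (by decide) (by decide) (by decide)
  have r2302 := xi_comm_one hD 2 3 0 2 2 0 3 (1) (by decide) (by decide) (by decide)
    (by decide) (by decide) (by decide)
  have r2303 := xi_comm_one hD 2 3 0 3 3 0 2 (-1) (by decide) (by decide) (by decide)
    (by decide) (by decide) (by decide)
  have r2312 := xi_comm_one hD 2 3 1 2 2 1 3 (1) (by decide) (by decide) (by decide)
    (by decide) (by decide) (by decide)
  have r2313 := xi_comm_one hD 2 3 1 3 3 1 2 (-1) (by decide) (by decide) (by decide)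
    (by decide) (by decide) (by decide)
  refine ⟨?_, ?_, ?_, ?_, ?_, ?_, ?_, ?_, ?_, ?_, ?_, ?_, ?_, ?_, ?_⟩
  all_goals
    intro v; simp only [eX, eY, fX, fY, hX, hY, map_add, map_sub, map_neg, map_smul, smul_add, smul_sub, smul_neg,
      r0201, r0301, r0302, r1201, r1202, r1203, r1301, r1302, r1303, r1312, r2301, r2302, r2303, r2312, r2313]; match_scalars <;> ring_nf <;> simp only [Complex.I_sq] <;> ring_nf

theorem A01 (D : VermaData F) (v : F) :
    D.ρξ 0 1 v = (Complex.I / 2) • (hxF D v + hyF D v) := by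
  rw [hX, hY]; match_scalars <;> ring_nf <;> simp only [Complex.I_sq] <;> ring_nf

theorem A23 (D : VermaData F) (v : F) :
    D.ρξ 2 3 v = -(Complex.I / 2) • (hxF D v - hyF D v) := by
  rw [hX, hY]; match_scalars <;> ring_nf <;> simp only [Complex.I_sq] <;> ring_nf

theorem A02 (D : VermaData F) (v : F) :
    D.ρξ 0 2 v = (2 : ℂ)⁻¹ • (fxF D v + fyF D v - exF D v - eyF D v) := by
  rw [eX, eY, fX, fY]; match_scalars <;> (ring_nf)

theorem A12 (D : VermaData F) (v : F) :
    D.ρξ 1 2 v = -(Complex.I / 2) • (fxF D v + fyF D v + exF D v + eyF D v) := by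
  rw [eX, eY, fX, fY]; match_scalars <;> ring_nf <;> simp only [Complex.I_sq] <;> ring_nf

theorem A13 (D : VermaData F) (v : F) :
    D.ρξ 1 3 v = (2 : ℂ)⁻¹ • (fxF D v - fyF D v - exF D v + eyF D v) := by
  rw [eX, eY, fX, fY]; match_scalars <;> (ring_nf)

theorem A03 (D : VermaData F) (v : F) :
    D.ρξ 0 3 v = (Complex.I / 2) • (exF D v - eyF D v + fxF D v - fyF D v) := by
  rw [eX, eY, fX, fY]; match_scalars <;> ring_nf <;> simp only [Complex.I_sq] <;> ring_nf

theorem rho_mem {D : VermaData F} (hD : IsVerma D) (p : Submodule ℂ F) (v : F)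
    (h : ∀ i j : Fin 4, i < j → D.ρξ i j v ∈ p) (i j : Fin 4) : D.ρξ i j v ∈ p := by
  rcases lt_trichotomy i j with hij | rfl | hij
  · exact h i j hij
  · rw [rho_diag hD]; simp
  · rw [hD.anti, LinearMap.neg_apply]; exact p.neg_mem (h j i hij)

theorem tc_scalar {D : VermaData F} (hD : IsVerma D) (hirr : IsIrred D) {wa wb wt wc : ℂ} {vμ : F}
    (hμ : IsHWvec D (wa, wb, wt, wc) vμ) (v : F) : D.ρt v = wt • v ∧ D.ρC v = wc • v := by
  obtain ⟨h0, -, -, -, -, ht, hc⟩ := hμ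
  let p : Submodule ℂ F := LinearMap.ker (D.ρt - wt • LinearMap.id) ⊓
    LinearMap.ker (D.ρC - wc • LinearMap.id)
  have hp : ∀ z, z ∈ p ↔ D.ρt z = wt • z ∧ D.ρC z = wc • z := by
    intro z; simp [p, sub_eq_zero]
  have : p = ⊥ ∨ p = ⊤ := by
    refine hirr.2 p fun z hz => ?_
    have hz' := (hp z).1 hz
    refine ⟨by rw [hz'.1]; exact p.smul_mem _ hz, by rw [hz'.2]; exact p.smul_mem _ hz, ?_⟩
    refine rho_mem hD p z fun i j hij => (hp _).2 ⟨?_, ?_⟩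
    · rw [← t_comm hD i j hij, hz'.1, map_smul]
    · rw [← c_comm hD i j hij, hz'.2, map_smul]
  have hv : vμ ∈ p := (hp _).2 ⟨ht, hc⟩
  rcases this with h | h
  · rw [h] at hv; exact absurd ((Submodule.mem_bot ℂ).1 hv) h0
  · exact (hp v).1 (h ▸ Submodule.mem_top)

theorem slPair {D : VermaData F} (hD : IsVerma D) (hirr : IsIrred D) {wa wb wt wc : ℂ} {vμ : F}
    (hμ : IsHWvec D (wa, wb, wt, wc) vμ) :
    SlPair (exF D) (fxF D) (hxF D) (eyF D) (fyF D) (hyF D) wa wb vμ := by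
  obtain ⟨hex, hfx, efx, hey, hfy, efy, cee, cef, ceh, cfe, cff, cfh, che, chf, chh⟩ := sl_relations hD
  have tc := tc_scalar hD hirr hμ
  obtain ⟨h0, h1, h2, h3, h4, -, -⟩ := hμ
  refine ⟨hex, hfx, efx, hey, hfy, efy, cee, cef, ceh, cfe, cff, cfh, che, chf, chh, ?_, h0, ?_, ?_, h3, h4⟩
  · intro p hp
    refine hirr.2 p fun z hz => ⟨by rw [(tc z).1]; exact p.smul_mem _ hz,
      by rw [(tc z).2]; exact p.smul_mem _ hz, ?_⟩
    obtain ⟨a1, a2, a3, a4, a5, a6⟩ := hp z hz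
    refine rho_mem hD p z fun i j hij => ?_
    have m01 : D.ρξ 0 1 z ∈ p := by
      rw [A01]; exact p.smul_mem _ (p.add_mem a3 a6)
    have m02 : D.ρξ 0 2 z ∈ p := by
      rw [A02]; exact p.smul_mem _ (p.sub_mem (p.sub_mem (p.add_mem a2 a5) a1) a4)
    have m03 : D.ρξ 0 3 z ∈ p := by
      rw [A03]; exact p.smul_mem _ (p.sub_mem (p.add_mem (p.sub_mem a1 a4) a2) a5)
    have m12 : D.ρξ 1 2 z ∈ p := by
      rw [A12]; exact p.smul_mem _ (p.add_mem (p.add_mem (p.add_mem a2 a5) a1) a4)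
    have m13 : D.ρξ 1 3 z ∈ p := by
      rw [A13]; exact p.smul_mem _ (p.add_mem (p.sub_mem (p.sub_mem a2 a5) a1) a4)
    have m23 : D.ρξ 2 3 z ∈ p := by
      rw [A23]; exact p.smul_mem _ (p.sub_mem a3 a6)
    fin_cases i <;> fin_cases j <;> first | exact absurd hij (by decide) | assumption
  · simp [exF, h1, h2]
  · simp [eyF, h1, h2]

end Final

section Final2

variable {F : Type*} [AddCommGroup F] [Module ℂ F]

/-- The general vector of degree one. -/
noncomputable def Uv (v0 v1 v2 v3 : F) : VInd F := bv 0 {0} v0 + bv 0 {1} v1 + bv 0 {2} v2 + bv 0 {3} v3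

theorem bv_add (k : ℕ) (L : Idx) (v w : F) : bv k L (v + w) = bv k L v + bv k L w := by simp [bv]

theorem bv_smul (k : ℕ) (L : Idx) (c : ℂ) (v : F) : bv k L (c • v) = c • bv k L v := by simp [bv]

theorem bv_neg (k : ℕ) (L : Idx) (v : F) : bv k L (-v) = -bv k L v := by simp [bv]

theorem bv_sub (k : ℕ) (L : Idx) (v w : F) : bv k L (v - w) = bv k L v - bv k L w := by
  simp [bv]

theorem bv_eq_zero (k : ℕ) (L : Idx) (v : F) : bv k L v = 0 ↔ v = 0 := by simp [bv]

theorem Uv_apply (v0 v1 v2 v3 : F) : Uv v0 v1 v2 v3 (0, {0}) = v0 ∧ Uv v0 v1 v2 v3 (0, {1}) = v1 ∧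
    Uv v0 v1 v2 v3 (0, {2}) = v2 ∧ Uv v0 v1 v2 v3 (0, {3}) = v3 := by
  simp [Uv, bv, Finsupp.single_apply]

theorem Uv_eq_zero (v0 v1 v2 v3 : F) :
    Uv v0 v1 v2 v3 = 0 ↔ v0 = 0 ∧ v1 = 0 ∧ v2 = 0 ∧ v3 = 0 := by
  constructor
  · intro h
    have := Uv_apply v0 v1 v2 v3
    rw [h] at this
    simp only [Finsupp.coe_zero, Pi.zero_apply] at this
    exact ⟨this.1.symm, this.2.1.symm, this.2.2.1.symm, this.2.2.2.symm⟩
  · rintro ⟨rfl, rfl, rfl, rfl⟩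
    simp [Uv, bv]

theorem Uv_homog (v0 v1 v2 v3 : F) : HomogDeg (Uv v0 v1 v2 v3) 1 := by
  intro p hp
  by_contra hne
  have h : ∀ l : Fin 4, ((0, {l}) : ℕ × Idx) ≠ p := by
    rintro l rfl; simp at hne
  rw [Finsupp.mem_support_iff] at hp
  apply hp
  simp [Uv, bv, Finsupp.single_apply, h]

theorem card_one : ∀ L : Idx, L.card = 1 → ∃ l : Fin 4, L = {l} := fun _ h => Finset.card_eq_one.1 h

theorem homog_eq {u : VInd F} (h : HomogDeg u 1) :
    u = Uv (u (0, {0})) (u (0, {1})) (u (0, {2})) (u (0, {3})) := by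
  ext ⟨k, L⟩
  by_cases hp : 2 * k + L.card = 1
  · obtain rfl : k = 0 := by omega
    obtain ⟨l, rfl⟩ := card_one L (by omega)
    have := Uv_apply (u (0, {0})) (u (0, {1})) (u (0, {2})) (u (0, {3}))
    fin_cases l
    · exact this.1.symm
    · exact this.2.1.symm
    · exact this.2.2.1.symm
    · exact this.2.2.2.symm
  · have e : ∀ z : VInd F, HomogDeg z 1 → z (k, L) = 0 := by
      intro z hz
      by_contra hne
      exact hp (hz (k, L) (Finsupp.mem_support_iff.2 hne))
    rw [e u h, e _ (Uv_homog _ _ _ _)]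

theorem card_three : ∀ I : Idx, I.card = 3 → ∃ k : Fin 4, I = {k}ᶜ := by decide

theorem txi_Uv {D : VermaData F} (hD : IsVerma D) (v0 v1 v2 v3 : F) :
    D.act 1 {0} (Uv v0 v1 v2 v3) =
      -bv 0 ∅ (D.ρt v0 + D.ρξ 0 1 v1 + D.ρξ 0 2 v2 + D.ρξ 0 3 v3) ∧
    D.act 1 {1} (Uv v0 v1 v2 v3) =
      -bv 0 ∅ (D.ρt v1 - D.ρξ 0 1 v0 + D.ρξ 1 2 v2 + D.ρξ 1 3 v3) ∧
    D.act 1 {2} (Uv v0 v1 v2 v3) =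
      -bv 0 ∅ (D.ρt v2 - D.ρξ 0 2 v0 - D.ρξ 1 2 v1 + D.ρξ 2 3 v3) ∧
    D.act 1 {3} (Uv v0 v1 v2 v3) =
      -bv 0 ∅ (D.ρt v3 - D.ρξ 0 3 v0 - D.ρξ 1 3 v1 - D.ρξ 2 3 v2) := by
  have h := hD.anti
  refine ⟨?_, ?_, ?_, ?_⟩ <;>
  · simp only [Uv, map_add, txi_eta hD, rho_diag hD, h 1 0, h 2 0, h 3 0, h 2 1, h 3 1, h 3 2,
      LinearMap.neg_apply, bv_add, bv_sub, bv_neg, Fin.reduceEq, if_true, if_false,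
      LinearMap.zero_apply, show bv 0 ∅ (0 : F) = 0 by simp [bv]]
    abel

theorem xi3_Uv {D : VermaData F} (hD : IsVerma D) (v0 v1 v2 v3 : F) :
    D.act 0 ({0}ᶜ) (Uv v0 v1 v2 v3) =
      bv 0 ∅ (-D.ρξ 2 3 v1 + D.ρξ 1 3 v2 - D.ρξ 1 2 v3 - D.ρC v0) ∧
    D.act 0 ({1}ᶜ) (Uv v0 v1 v2 v3) =
      bv 0 ∅ (-D.ρξ 2 3 v0 + D.ρξ 0 3 v2 - D.ρξ 0 2 v3 + D.ρC v1) ∧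
    D.act 0 ({2}ᶜ) (Uv v0 v1 v2 v3) =
      bv 0 ∅ (-D.ρξ 1 3 v0 + D.ρξ 0 3 v1 - D.ρξ 0 1 v3 - D.ρC v2) ∧
    D.act 0 ({3}ᶜ) (Uv v0 v1 v2 v3) =
      bv 0 ∅ (-D.ρξ 1 2 v0 + D.ρξ 0 2 v1 - D.ρξ 0 1 v2 + D.ρC v3) := by
  have s01 : ({0}ᶜ : Idx).erase 1 = {2, 3} := by decide
  have s02 : ({0}ᶜ : Idx).erase 2 = {1, 3} := by decide
  have s03 : ({0}ᶜ : Idx).erase 3 = {1, 2} := by decide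
  have s10 : ({1}ᶜ : Idx).erase 0 = {2, 3} := by decide
  have s12 : ({1}ᶜ : Idx).erase 2 = {0, 3} := by decide
  have s13 : ({1}ᶜ : Idx).erase 3 = {0, 2} := by decide
  have s20 : ({2}ᶜ : Idx).erase 0 = {1, 3} := by decide
  have s21 : ({2}ᶜ : Idx).erase 1 = {0, 3} := by decide
  have s23 : ({2}ᶜ : Idx).erase 3 = {0, 1} := by decide
  have s30 : ({3}ᶜ : Idx).erase 0 = {1, 2} := by decide
  have s31 : ({3}ᶜ : Idx).erase 1 = {0, 2} := by decide
  have s32 : ({3}ᶜ : Idx).erase 2 = {0, 1} := by decide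
  have d01 : dsign 1 ({0}ᶜ) = 1 := by decide
  have d02 : dsign 2 ({0}ᶜ) = -1 := by decide
  have d03 : dsign 3 ({0}ᶜ) = 1 := by decide
  have d10 : dsign 0 ({1}ᶜ) = 1 := by decide
  have d12 : dsign 2 ({1}ᶜ) = -1 := by decide
  have d13 : dsign 3 ({1}ᶜ) = 1 := by decide
  have d20 : dsign 0 ({2}ᶜ) = 1 := by decide
  have d21 : dsign 1 ({2}ᶜ) = -1 := by decide
  have d23 : dsign 3 ({2}ᶜ) = 1 := by decide
  have d30 : dsign 0 ({3}ᶜ) = 1 := by decide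
  have d31 : dsign 1 ({3}ᶜ) = -1 := by decide
  have d32 : dsign 2 ({3}ᶜ) = 1 := by decide
  have e0 : dsign 0 Finset.univ = 1 := by decide
  have e1 : dsign 1 Finset.univ = -1 := by decide
  have e2 : dsign 2 Finset.univ = 1 := by decide
  have e3 : dsign 3 Finset.univ = -1 := by decide
  have x := hD.vac_xi
  refine ⟨?_, ?_, ?_, ?_⟩ <;>
  · simp only [Uv, map_add, xi3_eta hD, s01, s02, s03, s10, s12, s13, s20, s21, s23, s30, s31, s32,
      d01, d02, d03, d10, d12, d13, d20, d21, d23, d30, d31, d32, e0, e1, e2, e3,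
      bv_add, bv_sub, bv_neg, Fin.reduceEq, if_true, if_false,
      x _ 0 1 (by decide), x _ 0 2 (by decide), x _ 0 3 (by decide), x _ 1 2 (by decide),
      x _ 1 3 (by decide), x _ 2 3 (by decide)]
    push_cast
    module

theorem sing_iff {D : VermaData F} (hD : IsVerma D) (v0 v1 v2 v3 : F) :
    (∀ (m : ℕ) (I : Idx), 2 < 2 * m + I.card → D.act m I (Uv v0 v1 v2 v3) = 0) ↔
      (D.ρt v0 + D.ρξ 0 1 v1 + D.ρξ 0 2 v2 + D.ρξ 0 3 v3 = 0 ∧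
       D.ρt v1 - D.ρξ 0 1 v0 + D.ρξ 1 2 v2 + D.ρξ 1 3 v3 = 0 ∧
       D.ρt v2 - D.ρξ 0 2 v0 - D.ρξ 1 2 v1 + D.ρξ 2 3 v3 = 0 ∧
       D.ρt v3 - D.ρξ 0 3 v0 - D.ρξ 1 3 v1 - D.ρξ 2 3 v2 = 0) ∧
      (-D.ρξ 2 3 v1 + D.ρξ 1 3 v2 - D.ρξ 1 2 v3 - D.ρC v0 = 0 ∧
       -D.ρξ 2 3 v0 + D.ρξ 0 3 v2 - D.ρξ 0 2 v3 + D.ρC v1 = 0 ∧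
       -D.ρξ 1 3 v0 + D.ρξ 0 3 v1 - D.ρξ 0 1 v3 - D.ρC v2 = 0 ∧
       -D.ρξ 1 2 v0 + D.ρξ 0 2 v1 - D.ρξ 0 1 v2 + D.ρC v3 = 0) := by
  obtain ⟨t0, t1, t2, t3⟩ := txi_Uv hD v0 v1 v2 v3
  obtain ⟨c0, c1, c2, c3⟩ := xi3_Uv hD v0 v1 v2 v3
  constructor
  · intro h
    have ht : ∀ i : Fin 4, D.act 1 {i} (Uv v0 v1 v2 v3) = 0 := fun i => h 1 {i} (by simp)
    have hc : ∀ k : Fin 4, D.act 0 ({k}ᶜ) (Uv v0 v1 v2 v3) = 0 := fun k =>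
      h 0 _ (by revert k; decide)
    refine ⟨⟨?_, ?_, ?_, ?_⟩, ?_, ?_, ?_, ?_⟩
    · exact (bv_eq_zero 0 ∅ _).1 (neg_eq_zero.1 (t0.symm.trans (ht 0)))
    · exact (bv_eq_zero 0 ∅ _).1 (neg_eq_zero.1 (t1.symm.trans (ht 1)))
    · exact (bv_eq_zero 0 ∅ _).1 (neg_eq_zero.1 (t2.symm.trans (ht 2)))
    · exact (bv_eq_zero 0 ∅ _).1 (neg_eq_zero.1 (t3.symm.trans (ht 3)))
    · exact (bv_eq_zero 0 ∅ _).1 (c0.symm.trans (hc 0))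
    · exact (bv_eq_zero 0 ∅ _).1 (c1.symm.trans (hc 1))
    · exact (bv_eq_zero 0 ∅ _).1 (c2.symm.trans (hc 2))
    · exact (bv_eq_zero 0 ∅ _).1 (c3.symm.trans (hc 3))
  · rintro ⟨⟨g0, g1, g2, g3⟩, k0, k1, k2, k3⟩ m I hI
    have z : bv 0 ∅ (0 : F) = 0 := by simp [bv]
    rw [g0, z, neg_zero] at t0
    rw [g1, z, neg_zero] at t1
    rw [g2, z, neg_zero] at t2
    rw [g3, z, neg_zero] at t3
    rw [k0, z] at c0
    rw [k1, z] at c1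
    rw [k2, z] at c2
    rw [k3, z] at c3
    by_cases h3 : 3 < 2 * m + I.card
    · simp [Uv, pos_eta_ge hD m I h3]
    · have hm : m = 0 ∨ m = 1 := by omega
      rcases hm with rfl | rfl
      · obtain ⟨k, rfl⟩ := card_three I (by omega)
        fin_cases k <;> assumption
      · obtain ⟨k, rfl⟩ := card_one I (by omega)
        fin_cases k <;> assumption

theorem Uv_congr_add (a0 a1 a2 a3 b0 b1 b2 b3 : F) :
    Uv a0 a1 a2 a3 + Uv b0 b1 b2 b3 = Uv (a0 + b0) (a1 + b1) (a2 + b2) (a3 + b3) := by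
  simp only [Uv, bv_add]; abel

theorem hw_iff {D : VermaData F} (hD : IsVerma D) (v0 v1 v2 v3 : F) :
    IsHW D (Uv v0 v1 v2 v3) ↔
      (e1F D v0 + v2 = 0 ∧ e1F D v1 - Complex.I • v2 = 0 ∧
        e1F D v2 + Complex.I • v1 - v0 = 0 ∧ e1F D v3 = 0) ∧
      (e2F D v0 + Complex.I • v3 = 0 ∧ e2F D v1 + v3 = 0 ∧ e2F D v2 = 0 ∧
        e2F D v3 - v1 - Complex.I • v0 = 0) := by
  have key : ∀ (j k : Fin 4) (hjk : j < k) (l : Fin 4) (v : F),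
      D.act 0 {j, k} (bv 0 {l} v) = bv 0 {l} (D.ρξ j k v) +
        ((if l = j then bv 0 {k} v else 0) - (if l = k then bv 0 {j} v else 0)) := by
    intro j k hjk l v
    rw [xi2_eta hD {j, k} (Finset.card_pair hjk.ne) l v _ (hD.vac_xi v j k hjk)]
    congr 1
    by_cases h1 : l = j
    · subst h1
      have a1 : dsign l {l, k} = 1 := by revert l k; decide
      have a2 : ({l, k} : Idx).erase l = {k} := by revert l k; decide
      rw [a1, a2, eta_vac hD]
      simp [hjk.ne]
    · by_cases h2 : l = k
      · subst h2
        have a1 : dsign l {j, l} = -1 := by revert l j; decide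
        have a2 : ({j, l} : Idx).erase l = {j} := by revert l j; decide
        rw [a1, a2, eta_vac hD]
        simp [h1]
      · simp [h1, h2]
  unfold IsHW
  have r1 : Complex.I • D.act 0 {1, 2} (Uv v0 v1 v2 v3) - D.act 0 {0, 2} (Uv v0 v1 v2 v3) =
      Uv (e1F D v0 + v2) (e1F D v1 - Complex.I • v2) (e1F D v2 + Complex.I • v1 - v0)
        (e1F D v3) := by
    simp only [Uv, map_add, key 1 2 (by decide), key 0 2 (by decide), Fin.reduceEq, if_true,
      if_false, e1F, LinearMap.add_apply, LinearMap.neg_apply, LinearMap.smul_apply, bv_add, bv_sub,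
      bv_neg, bv_smul]
    module
  have r2 : -(D.act 0 {1, 3} (Uv v0 v1 v2 v3)) - Complex.I • D.act 0 {0, 3} (Uv v0 v1 v2 v3) =
      Uv (e2F D v0 + Complex.I • v3) (e2F D v1 + v3) (e2F D v2)
        (e2F D v3 - v1 - Complex.I • v0) := by
    simp only [Uv, map_add, key 1 3 (by decide), key 0 3 (by decide), Fin.reduceEq, if_true,
      if_false, e2F, LinearMap.sub_apply, LinearMap.neg_apply, LinearMap.smul_apply, bv_add, bv_sub,
      bv_neg, bv_smul]
    module
  rw [r1, r2, Uv_eq_zero, Uv_eq_zero]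

/-- `w₁₁ ⊗ a + w₁₂ ⊗ b + w₂₁ ⊗ c + w₂₂ ⊗ d`. -/
noncomputable def Wv (a b c d : F) : VInd F :=
  Uv (Complex.I • (a - d)) (a + d) (Complex.I • (b + c)) (c - b)

theorem I_smul_cancel {z : F} : Complex.I • z = 0 ↔ z = 0 := by
  simp

theorem Wv_eq_zero (a b c d : F) : Wv a b c d = 0 ↔ a = 0 ∧ b = 0 ∧ c = 0 ∧ d = 0 := by
  rw [Wv, Uv_eq_zero, I_smul_cancel, I_smul_cancel]
  constructor
  · rintro ⟨h1, h2, h3, h4⟩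
    refine ⟨?_, ?_, ?_, ?_⟩
    · linear_combination (norm := module) (2 : ℂ)⁻¹ • h1 + (2 : ℂ)⁻¹ • h2
    · linear_combination (norm := module) (2 : ℂ)⁻¹ • h3 - (2 : ℂ)⁻¹ • h4
    · linear_combination (norm := module) (2 : ℂ)⁻¹ • h3 + (2 : ℂ)⁻¹ • h4
    · linear_combination (norm := module) (2 : ℂ)⁻¹ • h2 - (2 : ℂ)⁻¹ • h1
  · rintro ⟨rfl, rfl, rfl, rfl⟩
    simp

theorem Uv_eq_Wv (v0 v1 v2 v3 : F) : ∃ a b c d, Uv v0 v1 v2 v3 = Wv a b c d := by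
  refine ⟨(2 : ℂ)⁻¹ • (v1 - Complex.I • v0), (2 : ℂ)⁻¹ • (-v3 - Complex.I • v2),
    (2 : ℂ)⁻¹ • (v3 - Complex.I • v2), (2 : ℂ)⁻¹ • (v1 + Complex.I • v0), ?_⟩
  unfold Wv
  congr 1
  · match_scalars <;> ring_nf <;> simp only [Complex.I_sq] <;> ring_nf
  · module
  · match_scalars <;> ring_nf <;> simp only [Complex.I_sq] <;> ring_nf
  · module

theorem Wv_hw {D : VermaData F} (hD : IsVerma D) (a b c d : F) :
    IsHW D (Wv a b c d) ↔
      (exF D a + c = 0 ∧ eyF D a + b = 0 ∧ exF D d = 0 ∧ eyF D d = 0) ∧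
      (exF D b + d = 0 ∧ eyF D c + d = 0 ∧ exF D c = 0 ∧ eyF D b = 0) := by
  have E1 : ∀ v, e1F D v = exF D v + eyF D v := by
    intro v; simp only [exF, eyF, LinearMap.smul_apply, LinearMap.add_apply, LinearMap.sub_apply]
    module
  have E2 : ∀ v, e2F D v = exF D v - eyF D v := by
    intro v; simp only [exF, eyF, LinearMap.smul_apply, LinearMap.add_apply, LinearMap.sub_apply]
    module
  have R0 : e1F D (Complex.I • (a - d)) + Complex.I • (b + c) = Complex.I •
      ((exF D a + c) + (eyF D a + b) - exF D d - eyF D d) := by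
    simp only [E1, map_smul, map_sub]; module
  have R1 : e1F D (a + d) - Complex.I • (Complex.I • (b + c)) =
      (exF D a + c) + (eyF D a + b) + exF D d + eyF D d := by
    simp only [E1, map_add, smul_smul, Complex.I_mul_I]; module
  have R2 : e1F D (Complex.I • (b + c)) + Complex.I • (a + d) - Complex.I • (a - d) = Complex.I •
      ((exF D b + d) + (eyF D c + d) + exF D c + eyF D b) := by
    simp only [E1, map_smul, map_add]; module
  have R3 : e1F D (c - b) = exF D c + (eyF D c + d) - (exF D b + d) - eyF D b := by
    simp only [E1, map_sub]; module
  have S0 : e2F D (Complex.I • (a - d)) + Complex.I • (c - b) = Complex.I •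
      ((exF D a + c) - (eyF D a + b) - exF D d + eyF D d) := by
    simp only [E2, map_smul, map_sub]; module
  have S1 : e2F D (a + d) + (c - b) =
      (exF D a + c) - (eyF D a + b) + exF D d - eyF D d := by
    simp only [E2, map_add]; module
  have S2 : e2F D (Complex.I • (b + c)) = Complex.I •
      ((exF D b + d) - eyF D b + exF D c - (eyF D c + d)) := by
    simp only [E2, map_smul, map_add]; module
  have S3 : e2F D (c - b) - (a + d) - Complex.I • (Complex.I • (a - d)) =
      exF D c - (eyF D c + d) - (exF D b + d) + eyF D b := by
    simp only [E2, map_sub, smul_smul, Complex.I_mul_I]; module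
  rw [Wv, hw_iff hD, R0, R1, R2, R3, S0, S1, S2, S3, I_smul_cancel, I_smul_cancel, I_smul_cancel,
    I_smul_cancel]
  generalize exF D a + c = α1
  generalize eyF D a + b = α2
  generalize exF D d = β1
  generalize eyF D d = β2
  generalize exF D b + d = γ1
  generalize eyF D c + d = γ2
  generalize exF D c = ε1
  generalize eyF D b = ε2
  constructor
  · rintro ⟨⟨r0, r1, r2, r3⟩, s0, s1, s2, s3⟩
    refine ⟨⟨?_, ?_, ?_, ?_⟩, ?_, ?_, ?_, ?_⟩
    · linear_combination (norm := module) (4 : ℂ)⁻¹ • (r0 + r1 + s0 + s1)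
    · linear_combination (norm := module) (4 : ℂ)⁻¹ • (r0 + r1 - s0 - s1)
    · linear_combination (norm := module) (4 : ℂ)⁻¹ • (r1 - r0 - s0 + s1)
    · linear_combination (norm := module) (4 : ℂ)⁻¹ • (r1 - r0 + s0 - s1)
    · linear_combination (norm := module) (4 : ℂ)⁻¹ • (r2 - r3 + s2 - s3)
    · linear_combination (norm := module) (4 : ℂ)⁻¹ • (r2 + r3 - s2 - s3)
    · linear_combination (norm := module) (4 : ℂ)⁻¹ • (r2 + r3 + s2 + s3)
    · linear_combination (norm := module) (4 : ℂ)⁻¹ • (r2 - r3 - s2 + s3)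
  · rintro ⟨⟨rfl, rfl, rfl, rfl⟩, rfl, rfl, rfl, rfl⟩
    simp

theorem Wv_sing {D : VermaData F} (hD : IsVerma D) {wt wc : ℂ}
    (tc : ∀ v, D.ρt v = wt • v ∧ D.ρC v = wc • v) (a b c d : F) :
    (∀ (m : ℕ) (I : Idx), 2 < 2 * m + I.card → D.act m I (Wv a b c d) = 0) ↔
      ((2 : ℂ) • fxF D c + hxF D a - (wc - wt) • a = 0 ∧
       (2 : ℂ) • fyF D b + hyF D a - (-wc - wt) • a = 0 ∧
       (2 : ℂ) • exF D b - hxF D d - (wc - wt) • d = 0 ∧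
       (2 : ℂ) • eyF D c - hyF D d - (-wc - wt) • d = 0) ∧
      ((2 : ℂ) • fxF D d + hxF D b - (wc - wt) • b = 0 ∧
       (2 : ℂ) • eyF D a - hyF D b - (-wc - wt) • b = 0 ∧
       (2 : ℂ) • exF D a - hxF D c - (wc - wt) • c = 0 ∧
       (2 : ℂ) • fyF D d + hyF D c - (-wc - wt) • c = 0) := by
  rw [Wv, sing_iff hD]
  simp only [(tc _).1, (tc _).2, A01, A02, A03, A12, A13, A23]
  generalize hU1 : (2 : ℂ) • fxF D c + hxF D a - (wc - wt) • a = U1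
  generalize hU2 : (2 : ℂ) • fyF D b + hyF D a - (-wc - wt) • a = U2
  generalize hD1 : (2 : ℂ) • exF D b - hxF D d - (wc - wt) • d = D1
  generalize hD2 : (2 : ℂ) • eyF D c - hyF D d - (-wc - wt) • d = D2
  generalize hU3 : (2 : ℂ) • fxF D d + hxF D b - (wc - wt) • b = U3
  generalize hD3 : (2 : ℂ) • eyF D a - hyF D b - (-wc - wt) • b = D3
  generalize hD4 : (2 : ℂ) • exF D a - hxF D c - (wc - wt) • c = D4
  generalize hU4 : (2 : ℂ) • fyF D d + hyF D c - (-wc - wt) • c = U4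
  have main : ∀ G0 G1 G2 G3 H0 H1 H2 H3 : F,
      G0 = (Complex.I / 2) • (U1 + U2 - D1 - D2) → G1 = (2 : ℂ)⁻¹ • (U1 + U2 + D1 + D2) →
      G2 = (Complex.I / 2) • (U3 + D3 + D4 + U4) → G3 = (2 : ℂ)⁻¹ • (D4 + U4 - U3 - D3) →
      H0 = (Complex.I / 2) • (U1 - U2 + D2 - D1) → H1 = (2 : ℂ)⁻¹ • (-U1 + U2 + D2 - D1) →
      H2 = (Complex.I / 2) • (U3 - D3 - U4 + D4) → H3 = (2 : ℂ)⁻¹ • (U3 - D3 + U4 - D4) →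
      (((G0 = 0 ∧ G1 = 0 ∧ G2 = 0 ∧ G3 = 0) ∧ H0 = 0 ∧ H1 = 0 ∧ H2 = 0 ∧ H3 = 0) ↔
        (U1 = 0 ∧ U2 = 0 ∧ D1 = 0 ∧ D2 = 0) ∧ U3 = 0 ∧ D3 = 0 ∧ D4 = 0 ∧ U4 = 0) := by
    clear hU1 hU2 hU3 hU4 hD1 hD2 hD3 hD4
    rintro _ _ _ _ _ _ _ _ rfl rfl rfl rfl rfl rfl rfl rfl
    have hI : Complex.I / 2 ≠ 0 := by simp
    have h2 : (2 : ℂ)⁻¹ ≠ 0 := by simp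
    simp only [smul_eq_zero_iff_right hI, smul_eq_zero_iff_right h2]
    constructor
    · rintro ⟨⟨g0, g1, g2, g3⟩, k0, k1, k2, k3⟩
      refine ⟨⟨?_, ?_, ?_, ?_⟩, ?_, ?_, ?_, ?_⟩
      · linear_combination (norm := module) (4 : ℂ)⁻¹ • (g0 + g1 + k0 - k1)
      · linear_combination (norm := module) (4 : ℂ)⁻¹ • (g0 + g1 - k0 + k1)
      · linear_combination (norm := module) (4 : ℂ)⁻¹ • (g1 - g0 - k0 - k1)
      · linear_combination (norm := module) (4 : ℂ)⁻¹ • (g1 - g0 + k0 + k1)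
      · linear_combination (norm := module) (4 : ℂ)⁻¹ • (g2 - g3 + k2 + k3)
      · linear_combination (norm := module) (4 : ℂ)⁻¹ • (g2 - g3 - k2 - k3)
      · linear_combination (norm := module) (4 : ℂ)⁻¹ • (g2 + g3 + k2 - k3)
      · linear_combination (norm := module) (4 : ℂ)⁻¹ • (g2 + g3 - k2 + k3)
    · rintro ⟨⟨rfl, rfl, rfl, rfl⟩, rfl, rfl, rfl, rfl⟩
      simp
  apply main <;>
  · subst hU1 hU2 hU3 hU4 hD1 hD2 hD3 hD4
    simp only [map_add, map_sub, map_smul]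
    match_scalars <;> ring_nf <;> simp only [Complex.I_sq] <;> ring_nf

theorem Wv_iff {D : VermaData F} (hD : IsVerma D) {wt wc : ℂ}
    (tc : ∀ v, D.ρt v = wt • v ∧ D.ρC v = wc • v) (a b c d : F) :
    (IsSingular D (Wv a b c d) ∧ HomogDeg (Wv a b c d) 1 ∧ IsHW D (Wv a b c d)) ↔
    (¬ (a = 0 ∧ b = 0 ∧ c = 0 ∧ d = 0) ∧
      PairEqs (exF D) (fxF D) (hxF D) (wc - wt) a c ∧
      PairEqs (exF D) (fxF D) (hxF D) (wc - wt) b d ∧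
      PairEqs (eyF D) (fyF D) (hyF D) (-wc - wt) a b ∧
      PairEqs (eyF D) (fyF D) (hyF D) (-wc - wt) c d) := by
  rw [IsSingular, Wv_sing hD tc, Wv_hw hD, ne_eq, Wv_eq_zero]
  simp only [sub_eq_zero, add_eq_zero_iff_eq_neg]
  constructor
  · rintro ⟨⟨hne, ⟨u1, u2, d1, d2⟩, u3, d3, d4, u4⟩, -, ⟨p1, p2, p3, p4⟩, q1, q2, q3, q4⟩
    exact ⟨hne, ⟨q3, p1, u1, d4⟩, ⟨p3, q1, u3, d1⟩, ⟨q4, p2, u2, d3⟩, ⟨p4, q2, u4, d2⟩⟩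
  · rintro ⟨hne, ⟨q3, p1, u1, d4⟩, ⟨p3, q1, u3, d1⟩, ⟨q4, p2, u2, d3⟩, ⟨p4, q2, u4, d2⟩⟩
    exact ⟨⟨hne, ⟨u1, u2, d1, d2⟩, u3, d3, d4, u4⟩, Uv_homog _ _ _ _,
      ⟨p1, p2, p3, p4⟩, q1, q2, q3, q4⟩

theorem tens_add (x y : CA) (v : F) : tens (x + y) v = tens x v + tens y v := by
  unfold tens
  exact Finsupp.sum_add_index' (by simp) (by intro p s t; rw [add_smul, Finsupp.single_add])

theorem tens_smul_single (c : ℂ) (p : ℕ × Idx) (v : F) :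
    tens (Finsupp.single p c) v = Finsupp.single p (c • v) := by
  unfold tens
  exact Finsupp.sum_single_index (by simp)

theorem tens_w11 (v : F) : tens w11 v = Wv v 0 0 0 := by
  simp only [w11, Finsupp.smul_single, tens_add, tens_smul_single, Wv, Uv, bv]
  simp [add_comm]

theorem tens_w12 (v : F) : tens w12 v = Wv 0 v 0 0 := by
  simp only [w12, Finsupp.smul_single, ← Finsupp.single_neg, tens_add, tens_smul_single, Wv, Uv, bv]
  simp [add_comm]

theorem tens_w21 (v : F) : tens w21 v = Wv 0 0 v 0 := by
  simp only [w21, Finsupp.smul_single, tens_add, tens_smul_single, Wv, Uv, bv]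
  simp [add_comm]

theorem tens_w22 (v : F) : tens w22 v = Wv 0 0 0 v := by
  simp only [w22, Finsupp.smul_single, sub_eq_add_neg, ← Finsupp.single_neg, tens_add,
    tens_smul_single, Wv, Uv, bv]
  simp [add_comm]

theorem Wv_add (a b c d a' b' c' d' : F) :
    Wv a b c d + Wv a' b' c' d' = Wv (a + a') (b + b') (c + c') (d + d') := by
  simp only [Wv, Uv, bv_add, bv_sub, bv_smul]; module

theorem Wv_smul (r : ℂ) (a b c d : F) :
    r • Wv a b c d = Wv (r • a) (r • b) (r • c) (r • d) := by
  simp only [Wv, Uv, bv_add, bv_sub, bv_smul]; module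

theorem Wv_sub (a b c d a' b' c' d' : F) :
    Wv a b c d - Wv a' b' c' d' = Wv (a - a') (b - b') (c - c') (d - d') := by
  simp only [Wv, Uv, bv_add, bv_sub, bv_smul]; module

theorem Wv_inj (a b c d a' b' c' d' : F) :
    Wv a b c d = Wv a' b' c' d' ↔ a = a' ∧ b = b' ∧ c = c' ∧ d = d' := by
  rw [← sub_eq_zero, Wv_sub, Wv_eq_zero]
  simp only [sub_eq_zero]

end Final2

/-- **Classification of singular vectors of degree 1** (Theorem `sing1`).
Let `F` be an irreducible finite-dimensional `𝔤₀`-module with highest weight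
`μ = (wa, wb, wt, wc)` (with respect to `h_x, h_y, t, C`), realized with a highest weight
vector `vμ` (so that, in the polynomial realization, `vμ = x₁^m y₁^n`,
`fxF D vμ = m x₁^{m-1}x₂y₁^n` and `fyF D vμ = n x₁^m y₁^{n-1}y₂`).
A vector `u ∈ Ind F` is a nontrivial highest weight singular vector of degree 1 if and only
if, up to a scalar, it is one of:
* (a) `μ = (m, n, -(m+n)/2, (m-n)/2)`, `m, n ∈ ℤ≥0`, and `u = w₁₁ ⊗ x₁^m y₁^n`;
* (b) `μ = (m, n, 1+(m-n)/2, -1-(m+n)/2)`, `m > 0`, `n ≥ 0`, and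
      `u = w₂₁ ⊗ x₁^m y₁^n - w₁₁ ⊗ x₁^{m-1}x₂ y₁^n`;
* (c) `μ = (m, n, 2+(m+n)/2, (n-m)/2)`, `m, n > 0`, and
      `u = w₂₂ ⊗ x₁^m y₁^n - w₁₂ ⊗ x₁^{m-1}x₂ y₁^n - w₂₁ ⊗ x₁^m y₁^{n-1}y₂
           + w₁₁ ⊗ x₁^{m-1}x₂ y₁^{n-1}y₂`;
* (d) `μ = (m, n, 1+(n-m)/2, 1+(m+n)/2)`, `m ≥ 0`, `n > 0`, and
      `u = w₁₂ ⊗ x₁^m y₁^n - w₁₁ ⊗ x₁^m y₁^{n-1}y₂`. -/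
theorem degree_one_singular_vectors
    (F : Type*) [AddCommGroup F] [Module ℂ F] [FiniteDimensional ℂ F]
    (D : VermaData F) (hD : IsVerma D) (hirr : IsIrred D)
    (wa wb wt wc : ℂ) (vμ : F) (hμ : IsHWvec D (wa, wb, wt, wc) vμ)
    (u : VInd F) :
    (IsSingular D u ∧ HomogDeg u 1 ∧ IsHW D u) ↔
      ∃ c : ℂ, c ≠ 0 ∧
        ((∃ m n : ℕ, wa = m ∧ wb = n ∧ wt = -((m : ℂ) + n) / 2 ∧ wc = ((m : ℂ) - n) / 2 ∧
            u = c • tens w11 vμ) ∨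
         (∃ m n : ℕ, 0 < m ∧ wa = m ∧ wb = n ∧ wt = 1 + ((m : ℂ) - n) / 2 ∧
            wc = -1 - ((m : ℂ) + n) / 2 ∧
            u = c • (tens w21 vμ - (m : ℂ)⁻¹ • tens w11 (fxF D vμ))) ∨
         (∃ m n : ℕ, 0 < m ∧ 0 < n ∧ wa = m ∧ wb = n ∧ wt = 2 + ((m : ℂ) + n) / 2 ∧
            wc = ((n : ℂ) - m) / 2 ∧
            u = c • (tens w22 vμ - (m : ℂ)⁻¹ • tens w12 (fxF D vμ)
                  - (n : ℂ)⁻¹ • tens w21 (fyF D vμ)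
                  + ((m : ℂ) * n)⁻¹ • tens w11 (fxF D (fyF D vμ)))) ∨
         (∃ m n : ℕ, 0 < n ∧ wa = m ∧ wb = n ∧ wt = 1 + ((n : ℂ) - m) / 2 ∧
            wc = 1 + ((m : ℂ) + n) / 2 ∧
            u = c • (tens w12 vμ - (n : ℂ)⁻¹ • tens w11 (fyF D vμ)))) := by
  have S := slPair hD hirr hμ
  have tc := tc_scalar hD hirr hμ
  obtain ⟨m0, hm0⟩ := S.wa_nat
  obtain ⟨n0, hn0⟩ := S.swap.wa_nat
  have pos : ∀ k : ℕ, (k : ℂ) ≠ 0 ↔ 0 < k := fun k => by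
    rw [Nat.cast_ne_zero, Nat.pos_iff_ne_zero]
  by_cases hu : ∃ a b c d, u = Wv a b c d
  · obtain ⟨a, b, c, d, rfl⟩ := hu
    rw [Wv_iff hD tc, S.classify]
    subst hm0 hn0
    simp only [tens_w11, tens_w12, tens_w21, tens_w22, Wv_smul, Wv_add, Wv_sub, Wv_inj, smul_zero,
      sub_zero, zero_sub, add_zero, zero_add, neg_zero]
    refine exists_congr fun r => and_congr_right fun hr => ?_
    refine or_congr ?_ (or_congr ?_ (or_congr ?_ ?_))
    · constructor
      · rintro ⟨h1, h2, h⟩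
        exact ⟨m0, n0, rfl, rfl, by linear_combination (-1/2) * h1 + (-1/2) * h2,
          by linear_combination (1/2) * h1 - (1/2) * h2, h⟩
      · rintro ⟨m, n, hm, hn, h1, h2, h⟩
        rw [hm, hn]
        exact ⟨by rw [h1, h2]; ring, by rw [h1, h2]; ring, h⟩
    · constructor
      · rintro ⟨h0, h1, h2, h⟩
        exact ⟨m0, n0, (pos _).1 h0, rfl, rfl, by linear_combination (-1/2) * h1 + (-1/2) * h2,
          by linear_combination (1/2) * h1 - (1/2) * h2, h⟩
      · rintro ⟨m, n, h0, hm, hn, h1, h2, h⟩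
        rw [hm, hn]
        exact ⟨(pos _).2 h0, by rw [h1, h2]; ring, by rw [h1, h2]; ring, h⟩
    · constructor
      · rintro ⟨h0, h0', h1, h2, h⟩
        exact ⟨m0, n0, (pos _).1 h0, (pos _).1 h0', rfl, rfl,
          by linear_combination (-1/2) * h1 + (-1/2) * h2,
          by linear_combination (1/2) * h1 - (1/2) * h2, h⟩
      · rintro ⟨m, n, h0, h0', hm, hn, h1, h2, h⟩
        rw [hm, hn]
        exact ⟨(pos _).2 h0, (pos _).2 h0', by rw [h1, h2]; ring, by rw [h1, h2]; ring, h⟩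
    · constructor
      · rintro ⟨h0, h1, h2, h⟩
        exact ⟨m0, n0, (pos _).1 h0, rfl, rfl, by linear_combination (-1/2) * h1 + (-1/2) * h2,
          by linear_combination (1/2) * h1 - (1/2) * h2, h⟩
      · rintro ⟨m, n, h0, hm, hn, h1, h2, h⟩
        rw [hm, hn]
        exact ⟨(pos _).2 h0, by rw [h1, h2]; ring, by rw [h1, h2]; ring, h⟩
  · constructor
    · rintro ⟨-, h, -⟩
      obtain ⟨a, b, c, d, h'⟩ := Uv_eq_Wv (u (0, {0})) (u (0, {1})) (u (0, {2})) (u (0, {3}))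
      exact absurd ⟨a, b, c, d, (homog_eq h).trans h'⟩ hu
    · rintro ⟨r, -, h⟩
      exfalso
      apply hu
      simp only [tens_w11, tens_w12, tens_w21, tens_w22, Wv_smul, Wv_add, Wv_sub] at h
      rcases h with ⟨_, _, _, _, _, _, h⟩ | ⟨_, _, _, _, _, _, _, h⟩ |
        ⟨_, _, _, _, _, _, _, _, h⟩ | ⟨_, _, _, _, _, _, _, h⟩ <;> exact ⟨_, _, _, _, h⟩
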